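/- arXiv:2604.10274 — 3 statements merged into one kernel-verified Lean document; each statement's English description precedes it below -/
import Mathlib

section
/- Fix ι ∈ {0,1} and let D be a divergence satisfying channel-DPI. Then inf{D(π_ι‖π_ῑ) : (π_ι, π_ῑ) ∈ Π_ι × Π_ῑ} = inf{D(ν_ῑ^{(π)}‖ν_ῑ) : π ∈ Π_ι}. Moreover: (1) if π* ∈ Π_ι attains the right-hand infimum and π' is any proportional response to π*, then (π*, π') attains the left-hand infimum; (2) if (π_ι*, π_ῑ*) ∈ Π_ι × Π_ῑ attains the left-hand infimum, then π_ι* attains the right-hand infimum. -/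
/- STATEMENT 0: Paired-to-one-sided reduction (Lemma: reduction of the paired problem to the
one-sided problem).  The side `ι ∈ {0,1}` is formalized abstractly: `X` plays the role of `Ω_ι`
and `Y` the role of `Ω_ῑ`, with the closed edge relation `E ⊆ X × Y` and both-sided nonempty
neighborhoods; the case `ι = 1` is obtained by instantiating with the transposed relation. -/

open MeasureTheory ProbabilityTheory Filter
open scoped ENNReal NNReal

noncomputable section

structure Divergence : Type 1 where
  D : (Ω : Type) → [MeasurableSpace Ω] → Measure Ω → Measure Ω → EReal

/-- Channel data-processing inequality. -/
def Divergence.HasDPI (𝒟 : Divergence) : Prop :=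
  ∀ (Ω Ω' : Type) [MeasurableSpace Ω] [MeasurableSpace Ω']
    (K : Kernel Ω Ω') [IsMarkovKernel K]
    (P Q : Measure Ω) [IsFiniteMeasure P] [IsFiniteMeasure Q],
    𝒟.D Ω' (P.bind K) (Q.bind K) ≤ 𝒟.D Ω P Q

variable {X Y : Type} [MeasurableSpace X] [MeasurableSpace Y]

/-- Refinements of `νX` on side `X`: finite plans concentrated on `E` with `X`-marginal `νX`. -/
def Plans (E : Set (X × Y)) (νX : Measure X) : Set (Measure (X × Y)) :=
  {π | IsFiniteMeasure π ∧ π Eᶜ = 0 ∧ π.map Prod.fst = νX}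

/-- Refinements of `νY` on side `Y`. -/
def PlansSnd (E : Set (X × Y)) (νY : Measure Y) : Set (Measure (X × Y)) :=
  {π | IsFiniteMeasure π ∧ π Eᶜ = 0 ∧ π.map Prod.snd = νY}

/-- `η ⋈ L`: the plan on `X × Y` built from a measure `η` on `Y` and a kernel `L : Y ⤳ X`,
so that `(η ⋈ L)(A × B) = ∫_B L (y, A) dη (y)`. -/
def mix (η : Measure Y) (L : Kernel Y X) : Measure (X × Y) :=
  η.bind (fun y => (L y).map (fun x => (x, y)))

/-- `π'` is a proportional response to the side-`X` refinement `π`. -/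
def IsPropResponse (E : Set (X × Y)) (νY : Measure Y) (π π' : Measure (X × Y)) : Prop :=
  ∃ K : Kernel Y X, IsFiniteKernel K ∧
    ∃ Kfb : Kernel Y X, IsMarkovKernel Kfb ∧
      π = mix (π.map Prod.snd) K ∧
      (∀ᵐ y ∂(νY.singularPart (π.map Prod.snd)), Kfb y {x | (x, y) ∈ E} = 1) ∧
      π' = mix ((π.map Prod.snd).withDensity (νY.rnDeriv (π.map Prod.snd))) K
            + mix (νY.singularPart (π.map Prod.snd)) Kfb

theorem exists_measurable_rightInverse_of_compact {Z Y : Type*} [MetricSpace Z] [CompactSpace Z]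
    [Nonempty Z] [MeasurableSpace Z] [BorelSpace Z] [TopologicalSpace Y] [T2Space Y]
    [MeasurableSpace Y] [BorelSpace Y] {g : Z → Y} (hg : Continuous g) :
    ∃ s : Y → Z, Measurable s ∧ ∀ y ∈ Set.range g, g (s y) = y := by
  obtain ⟨q, hq, hqs⟩ := exists_nat_bool_continuous_surjective_of_compact Z
  obtain ⟨c, hc, hcs⟩ : ∃ c : cantorSet → Z, Continuous c ∧ Function.Surjective c :=
    ⟨q ∘ cantorSetHomeomorphNatToBool, hq.comp cantorSetHomeomorphNatToBool.continuous,
      hqs.comp cantorSetHomeomorphNatToBool.surjective⟩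
  have hgc : Continuous (g ∘ c) := hg.comp hc
  have : CompactSpace cantorSet := isCompact_iff_compactSpace.mp isCompact_cantorSet
  let fib (y : Y) : Set ℝ := Subtype.val '' ((g ∘ c) ⁻¹' {y})
  have hfib_compact (y : Y) : IsCompact (fib y) :=
    ((isClosed_singleton.preimage hgc).isCompact).image continuous_subtype_val
  have hfib_ne {y : Y} (hy : y ∈ Set.range g) : (fib y).Nonempty := by
    obtain ⟨z, rfl⟩ := hy
    obtain ⟨t, rfl⟩ := hcs z
    exact ⟨t, t, rfl, rfl⟩
  have hrange : MeasurableSet (Set.range g) := (isCompact_range hg).measurableSet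
  have hmin : Measurable fun y ↦ sInf (fib y) := by
    refine measurable_of_Iic fun t ↦ ?_
    have hpre : (fun y ↦ sInf (fib y)) ⁻¹' Set.Iic t
        = (g ∘ c) '' (Subtype.val ⁻¹' Set.Iic t) ∪ ((Set.range g)ᶜ ∩ {_y | (0 : ℝ) ≤ t}) := by
      ext y
      simp only [Set.mem_preimage, Set.mem_Iic, Set.mem_union, Set.mem_inter_iff,
        Set.mem_compl_iff, Set.mem_ofPred_eq]
      by_cases hy : y ∈ Set.range g
      · simp only [hy, not_true_eq_false, false_and, or_false]
        constructor
        · intro h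
          obtain ⟨u, hu, hu'⟩ := (hfib_compact y).sInf_mem (hfib_ne hy)
          exact ⟨u, by simpa [hu'] using h, hu⟩
        · rintro ⟨u, hu, rfl⟩
          exact (csInf_le (hfib_compact _).bddBelow ⟨u, rfl, rfl⟩).trans hu
      · have hempty : fib y = ∅ := by
          rw [Set.eq_empty_iff_forall_notMem]
          rintro _ ⟨u, hu, rfl⟩
          exact hy ⟨c u, hu⟩
        have himage : y ∉ (g ∘ c) '' (Subtype.val ⁻¹' Set.Iic t) := by
          rintro ⟨u, -, hu⟩
          exact hy ⟨c u, hu⟩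
        simp only [hempty, hy, himage, Real.sInf_empty, not_false_eq_true, true_and, false_or]
    rw [hpre]
    exact (((isClosed_Iic.preimage continuous_subtype_val).isCompact.image hgc).measurableSet).union
      (hrange.compl.inter (MeasurableSet.const _))
  classical
  let m (y : Y) : ℝ := if y ∈ Set.range g then sInf (fib y) else 0
  have hm : Measurable m := Measurable.ite hrange hmin measurable_const
  have hm_mem (y : Y) : m y ∈ cantorSet := by
    by_cases hy : y ∈ Set.range g
    · obtain ⟨u, -, hu⟩ := (hfib_compact y).sInf_mem (hfib_ne hy)
      simp only [m, if_pos hy, ← hu, u.2]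
    · simpa only [m, if_neg hy] using zero_mem_cantorSet
  refine ⟨fun y ↦ c ⟨m y, hm_mem y⟩, hc.measurable.comp (hm.subtype_mk), fun y hy ↦ ?_⟩
  obtain ⟨u, hu, hu'⟩ := (hfib_compact y).sInf_mem (hfib_ne hy)
  have : (⟨m y, hm_mem y⟩ : cantorSet) = u := Subtype.ext (by simp only [m, if_pos hy, hu'])
  change g (c ⟨m y, hm_mem y⟩) = y
  rw [this]
  exact hu

theorem iInter_closure_image_subset {Y : Type*} [MetricSpace Y] {g : (ℕ → ℕ) → Y}
    (hg : Continuous g) (n : ℕ → ℕ) :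
    ⋂ k, closure (g '' {x | ∀ i < k, x i ≤ n i}) ⊆ g '' Set.Iic n := by
  intro y hy
  have hnear (k : ℕ) : ∃ x : ℕ → ℕ, (∀ i < k, x i ≤ n i) ∧ dist y (g x) < 1 / ((k : ℝ) + 1) := by
    obtain ⟨_, ⟨x, hx, rfl⟩, hd⟩ :=
      Metric.mem_closure_iff.mp (Set.mem_iInter.mp hy k) _ (Nat.one_div_pos_of_nat (n := k))
    exact ⟨x, hx, hd⟩
  choose x hx hd using hnear
  have hcompact : IsCompact (Set.Iic n) := by
    rw [← Set.pi_univ_Iic]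
    exact isCompact_univ_pi fun i ↦ (Set.finite_Iic (n i)).isCompact
  obtain ⟨z, hz, φ, hφ, hlim⟩ :=
    hcompact.tendsto_subseq (x := fun k ↦ x k ⊓ n) fun k ↦ Set.mem_Iic.mpr inf_le_right
  have hlim' : Tendsto (x ∘ φ) atTop (nhds z) := by
    rw [tendsto_pi_nhds] at hlim ⊢
    intro i
    refine (hlim i).congr' ?_
    filter_upwards [eventually_gt_atTop i] with k hk
    exact min_eq_left (hx (φ k) i (hk.trans_le (hφ.id_le k)))
  have hgy : Tendsto (fun k ↦ g (x k)) atTop (nhds y) := by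
    rw [tendsto_iff_dist_tendsto_zero]
    refine squeeze_zero (fun _ ↦ dist_nonneg) (fun k ↦ ?_) tendsto_one_div_add_atTop_nhds_zero_nat
    rw [dist_comm]
    exact (hd k).le
  exact ⟨z, hz, tendsto_nhds_unique ((hg.tendsto z).comp hlim') (hgy.comp hφ.tendsto_atTop)⟩

theorem exists_le_measure_image_Iic {Y : Type*} [MetricSpace Y] [MeasurableSpace Y] [BorelSpace Y]
    (μ : Measure Y) [IsFiniteMeasure μ] {g : (ℕ → ℕ) → Y} (hg : Continuous g)
    {c : ℝ≥0∞} (hc : c < μ (Set.range g)) : ∃ n : ℕ → ℕ, c ≤ μ (g '' Set.Iic n) := by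
  have step (T : Set (ℕ → ℕ)) (k : ℕ) :
      ∃ m : ℕ, c < μ (g '' T) → c < μ (g '' (T ∩ {x | x k ≤ m})) := by
    by_cases hT : c < μ (g '' T)
    · have hmono : Monotone fun m : ℕ ↦ g '' (T ∩ {x | x k ≤ m}) := fun a b hab ↦
        Set.image_mono (Set.inter_subset_inter_right T fun x (hx : x k ≤ a) ↦ hx.trans hab)
      have hunion : ⋃ m : ℕ, g '' (T ∩ {x | x k ≤ m}) = g '' T := by
        rw [← Set.image_iUnion, ← Set.inter_iUnion,
          Set.iUnion_eq_univ_iff.mpr fun x ↦ ⟨x k, le_refl (x k)⟩, Set.inter_univ]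
      rw [← hunion, hmono.measure_iUnion, lt_iSup_iff] at hT
      exact hT.imp fun m hm _ ↦ hm
    · exact ⟨0, fun h ↦ absurd h hT⟩
  choose m hm using step
  let T : ℕ → Set (ℕ → ℕ) := fun k ↦ Nat.rec Set.univ (fun k T ↦ T ∩ {x | x k ≤ m T k}) k
  let n (k : ℕ) : ℕ := m (T k) k
  have hT (k : ℕ) : T k = {x | ∀ i < k, x i ≤ n i} := by
    induction k with
    | zero => ext x; simp [T]
    | succ k ih =>
      change T k ∩ {x | x k ≤ n k} = _
      rw [ih]
      ext x
      simp only [Set.mem_inter_iff, Set.mem_ofPred_eq, Nat.lt_succ_iff_lt_or_eq]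
      grind
  have hcT (k : ℕ) : c < μ (g '' T k) := by
    induction k with
    | zero => simpa [T] using hc
    | succ k ih => exact hm _ _ ih
  have hanti : Antitone fun k ↦ closure (g '' {x | ∀ i < k, x i ≤ n i}) := fun a b hab ↦
    closure_mono (Set.image_mono fun x hx i hi ↦ hx i (hi.trans_le hab))
  refine ⟨n, le_trans ?_ (measure_mono (iInter_closure_image_subset hg n))⟩
  rw [hanti.measure_iInter (fun k ↦ isClosed_closure.nullMeasurableSet) ⟨0, measure_ne_top _ _⟩]
  refine le_iInf fun k ↦ ?_
  rw [← hT k]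
  exact (hcT k).le.trans (measure_mono subset_closure)

theorem exists_measurable_ae_rightInverse_nat {Y : Type*} [MetricSpace Y] [MeasurableSpace Y]
    [BorelSpace Y] (μ : Measure Y) [IsFiniteMeasure μ] {g : (ℕ → ℕ) → Y} (hg : Continuous g)
    (hsurj : Function.Surjective g) :
    ∃ s : Y → ℕ → ℕ, Measurable s ∧ ∀ᵐ y ∂μ, g (s y) = y := by
  have hlarge (k : ℕ) : ∃ n : ℕ → ℕ, μ Set.univ - ((k : ℝ≥0∞) + 1)⁻¹ ≤ μ (g '' Set.Iic n) := by
    by_cases h0 : μ Set.univ = 0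
    · exact ⟨0, by simp [h0]⟩
    · refine exists_le_measure_image_Iic μ hg ?_
      rw [hsurj.range_eq]
      exact ENNReal.sub_lt_self (measure_ne_top _ _) h0 (by simp)
  choose n hn using hlarge
  have hcompact (k : ℕ) : IsCompact (Set.Iic (n k)) := by
    rw [← Set.pi_univ_Iic]
    exact isCompact_univ_pi fun i ↦ (Set.finite_Iic (n k i)).isCompact
  have hB (k : ℕ) : MeasurableSet (g '' Set.Iic (n k)) := ((hcompact k).image hg).measurableSet
  have hsec (k : ℕ) : ∃ s : Y → ℕ → ℕ, Measurable s ∧ ∀ y ∈ g '' Set.Iic (n k), g (s y) = y := by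
    let := TopologicalSpace.metrizableSpaceMetric (Set.Iic (n k))
    have : CompactSpace (Set.Iic (n k)) := isCompact_iff_compactSpace.mp (hcompact k)
    obtain ⟨s, hs, hgs⟩ := exists_measurable_rightInverse_of_compact
      (hg.comp (continuous_subtype_val (p := (· ∈ Set.Iic (n k)))))
    refine ⟨fun y ↦ s y, measurable_subtype_coe.comp hs, ?_⟩
    rintro _ ⟨x, hx, rfl⟩
    exact hgs _ ⟨⟨x, hx⟩, rfl⟩
  choose s hs hgs using hsec
  classical
  let p (k : ℕ) (y : Y) : Prop := y ∈ g '' Set.Iic (n k) ∨ y ∉ ⋃ j, g '' Set.Iic (n j)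
  have hp (y : Y) : ∃ k, p k y := by
    by_cases hy : y ∈ ⋃ j, g '' Set.Iic (n j)
    · exact (Set.mem_iUnion.mp hy).imp fun k hk ↦ Or.inl hk
    · exact ⟨0, Or.inr hy⟩
  refine ⟨fun y ↦ s (Nat.find (hp y)) y,
    Measurable.find (p := p) hs (fun k ↦ (hB k).union (MeasurableSet.iUnion hB).compl) hp, ?_⟩
  have hnull : μ (⋃ j, g '' Set.Iic (n j))ᶜ = 0 := by
    rw [measure_compl (MeasurableSet.iUnion hB) (measure_ne_top _ _), tsub_eq_zero_iff_le]
    refine ENNReal.le_of_forall_pos_le_add fun ε hε _ ↦ ?_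
    obtain ⟨k, hk⟩ := ENNReal.exists_inv_nat_lt (ENNReal.coe_pos.mpr hε).ne'
    calc μ Set.univ ≤ μ (g '' Set.Iic (n k)) + ((k : ℝ≥0∞) + 1)⁻¹ := tsub_le_iff_right.mp (hn k)
      _ ≤ _ := add_le_add (measure_mono (Set.subset_iUnion (fun j ↦ g '' Set.Iic (n j)) k))
        ((ENNReal.inv_le_inv.mpr le_self_add).trans hk.le)
  filter_upwards [measure_eq_zero_iff_ae_notMem.mp hnull] with y hy
  rcases Nat.find_spec (hp y) with h | h
  · exact hgs _ y h
  · exact absurd h hy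

theorem exists_measurable_ae_selection [TopologicalSpace X] [PolishSpace X] [BorelSpace X]
    [TopologicalSpace Y] [PolishSpace Y] [BorelSpace Y] [Nonempty Y] {E : Set (X × Y)}
    (hE : IsClosed E) (hNbhd : ∀ y, ∃ x, (x, y) ∈ E) (μ : Measure Y) [IsFiniteMeasure μ] :
    ∃ f : Y → X, Measurable f ∧ ∀ᵐ y ∂μ, (f y, y) ∈ E := by
  let := TopologicalSpace.metrizableSpaceMetric Y
  have : PolishSpace E := hE.polishSpace
  have : Nonempty E := by
    obtain ⟨x, hx⟩ := hNbhd (Classical.arbitrary Y)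
    exact ⟨⟨_, hx⟩⟩
  obtain ⟨e, he, hes⟩ := PolishSpace.exists_nat_nat_continuous_surjective E
  have hval : Continuous fun t ↦ (e t : X × Y) := continuous_subtype_val.comp he
  obtain ⟨s, hs, hgs⟩ := exists_measurable_ae_rightInverse_nat μ (continuous_snd.comp hval)
    (fun y ↦ by
      obtain ⟨x, hx⟩ := hNbhd y
      obtain ⟨t, ht⟩ := hes ⟨_, hx⟩
      exact ⟨t, by simp [ht]⟩)
  refine ⟨fun y ↦ (e (s y) : X × Y).1, (continuous_fst.comp hval).measurable.comp hs, ?_⟩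
  filter_upwards [hgs] with y hy
  convert (e (s y)).2 using 1
  exact Prod.ext rfl hy.symm

theorem mix_eq_map_compProd (η : Measure Y) [SFinite η] (L : Kernel Y X) [IsSFiniteKernel L] :
    mix η L = (η ⊗ₘ L).map Prod.swap := by
  have hfun : (fun y ↦ (L y).map (fun x ↦ (x, y))) = ⇑((Kernel.id ×ₖ L).map Prod.swap) := by
    funext y
    rw [Kernel.map_apply _ measurable_swap, Kernel.prod_apply, Kernel.id_apply,
      Measure.dirac_prod, Measure.map_map measurable_swap measurable_prodMk_left]
    rfl
  rw [mix, hfun, Measure.compProd_eq_comp_prod, Measure.map_comp _ _ measurable_swap]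

theorem mix_eq_bind (η : Measure Y) [SFinite η] (L : Kernel Y X) [IsSFiniteKernel L] :
    mix η L = η.bind ((Kernel.id ×ₖ L).map Prod.swap) := by
  rw [mix_eq_map_compProd, Measure.compProd_eq_comp_prod, Measure.map_comp _ _ measurable_swap]

theorem mix_congr {η : Measure Y} {L L' : Kernel Y X} (h : ∀ᵐ y ∂η, L y = L' y) :
    mix η L = mix η L' :=
  Measure.bind_congr_right (h.mono fun y hy ↦ by simp only [hy])

theorem map_snd_mix (η : Measure Y) [SFinite η] (L : Kernel Y X) [IsMarkovKernel L] :
    (mix η L).map Prod.snd = η := by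
  rw [mix_eq_map_compProd, Measure.map_map measurable_snd measurable_swap]
  exact Measure.fst_compProd η L

theorem mix_add (η η' : Measure Y) [SFinite η] [SFinite η'] (L : Kernel Y X) [IsSFiniteKernel L] :
    mix (η + η') L = mix η L + mix η' L := by
  simp only [mix_eq_map_compProd, Measure.compProd_add_left, Measure.map_add _ _ measurable_swap]

theorem mix_compl_eq_zero_iff (η : Measure Y) [SFinite η] (L : Kernel Y X) [IsSFiniteKernel L]
    {E : Set (X × Y)} (hE : MeasurableSet E) :
    mix η L Eᶜ = 0 ↔ ∀ᵐ y ∂η, ∀ᵐ x ∂L y, (x, y) ∈ E := by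
  rw [mix_eq_map_compProd, Measure.map_apply measurable_swap hE.compl]
  exact Measure.ae_compProd_iff (measurable_swap hE)

theorem ae_apply_univ_eq_one (η : Measure Y) [IsFiniteMeasure η] (L : Kernel Y X)
    [IsFiniteKernel L] (h : (mix η L).map Prod.snd = η) : ∀ᵐ y ∂η, L y Set.univ = 1 := by
  refine ae_eq_of_forall_setLIntegral_eq_of_sigmaFinite (L.measurable_coe MeasurableSet.univ)
    measurable_const fun B hB _ ↦ ?_
  rw [setLIntegral_one]
  conv_rhs => rw [← h, mix_eq_map_compProd, Measure.map_map measurable_snd measurable_swap,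
    Measure.map_apply (measurable_snd.comp measurable_swap) hB]
  have hpre : (Prod.snd ∘ Prod.swap : Y × X → Y) ⁻¹' B = B ×ˢ Set.univ := by ext; simp
  rw [hpre, Measure.compProd_apply_prod hB MeasurableSet.univ]

/-- Gluing the two kernels of a proportional response into one channel that produces both plans
from their `Y`-marginals. -/
theorem IsPropResponse.exists_isMarkovKernel {E : Set (X × Y)} (hE : MeasurableSet E)
    {νY : Measure Y} [IsFiniteMeasure νY] {π π' : Measure (X × Y)} [IsFiniteMeasure π]
    (hπE : π Eᶜ = 0) (h : IsPropResponse E νY π π') :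
    ∃ L : Kernel Y X, IsMarkovKernel L ∧ π = mix (π.map Prod.snd) L ∧ π' = mix νY L ∧
      π' Eᶜ = 0 := by
  obtain ⟨K, hK, Kfb, hKfb, hπ, hfb, hπ'⟩ := h
  set P := π.map Prod.snd with hP
  have hac : P.withDensity (νY.rnDeriv P) ≪ P := withDensity_absolutelyContinuous _ _
  have hac_fin : IsFiniteMeasure (P.withDensity (νY.rnDeriv P)) :=
    isFiniteMeasure_of_le νY (Measure.withDensity_rnDeriv_le νY P)
  have hone : ∀ᵐ y ∂P, K y Set.univ = 1 := ae_apply_univ_eq_one P K (by rw [← hπ])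
  have hKE : ∀ᵐ y ∂P, ∀ᵐ x ∂K y, (x, y) ∈ E := (mix_compl_eq_zero_iff P K hE).mp (hπ ▸ hπE)
  obtain ⟨S, hS, hsS, hPS⟩ := Measure.mutuallySingular_singularPart νY P
  have hT : MeasurableSet (S ∩ {y | K y Set.univ = 1}) :=
    hS.inter (K.measurable_coe MeasurableSet.univ (measurableSet_singleton 1))
  classical
  let L : Kernel Y X := Kernel.piecewise hT K Kfb
  have hL : IsMarkovKernel L := ⟨fun y ↦ ⟨by
    simp only [L, Kernel.piecewise_apply]
    split_ifs with hy
    · exact hy.2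
    · exact measure_univ⟩⟩
  have hLK : ∀ᵐ y ∂P, K y = L y := by
    filter_upwards [hone, measure_eq_zero_iff_ae_notMem.mp hPS] with y hy hyS
    simp only [L, Kernel.piecewise_apply]
    rw [if_pos ⟨not_not.mp hyS, hy⟩]
  have hLfb : ∀ᵐ y ∂νY.singularPart P, Kfb y = L y := by
    filter_upwards [measure_eq_zero_iff_ae_notMem.mp hsS] with y hyS
    simp only [L, Kernel.piecewise_apply]
    rw [if_neg fun hy ↦ hyS hy.1]
  have hfbE : ∀ᵐ y ∂νY.singularPart P, ∀ᵐ x ∂Kfb y, (x, y) ∈ E := by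
    filter_upwards [hfb] with y hy
    exact (prob_compl_eq_zero_iff (measurable_prodMk_right hE)).mpr hy
  refine ⟨L, hL, hπ.trans (mix_congr hLK), ?_, ?_⟩
  · rw [hπ', mix_congr (hac.ae_le hLK), mix_congr hLfb, ← mix_add]
    congr 1
    rw [add_comm]
    exact (νY.haveLebesgueDecomposition_add P).symm
  · rw [hπ', Measure.add_apply, (mix_compl_eq_zero_iff _ K hE).mpr (hac.ae_le hKE),
      (mix_compl_eq_zero_iff _ Kfb hE).mpr hfbE, add_zero]

theorem exists_isPropResponse [TopologicalSpace X] [PolishSpace X] [BorelSpace X]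
    [TopologicalSpace Y] [PolishSpace Y] [BorelSpace Y] [Nonempty Y] {E : Set (X × Y)}
    (hE : IsClosed E) (hNbhd : ∀ y, ∃ x, (x, y) ∈ E) (νY : Measure Y) [IsFiniteMeasure νY]
    (π : Measure (X × Y)) [IsFiniteMeasure π] : ∃ π', IsPropResponse E νY π π' := by
  have : Nonempty X := ⟨(hNbhd (Classical.arbitrary Y)).choose⟩
  obtain ⟨f, hf, hfE⟩ := exists_measurable_ae_selection hE hNbhd (νY.singularPart (π.map Prod.snd))
  refine ⟨_, (π.map Prod.swap).condKernel, inferInstance, Kernel.deterministic f hf, inferInstance,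
    ?_, ?_, rfl⟩
  · have hfst : (π.map Prod.swap).fst = π.map Prod.snd := by
      rw [Measure.fst, Measure.map_map measurable_fst measurable_swap]
      rfl
    rw [mix_eq_map_compProd, ← hfst, Measure.disintegrate,
      Measure.map_map measurable_swap measurable_swap, Prod.swap_swap_eq, Measure.map_id]
  · filter_upwards [hfE] with y hy
    rw [Kernel.deterministic_apply]
    exact Measure.dirac_apply_of_mem hy

theorem Divergence.HasDPI.map_snd_le {𝒟 : Divergence} (h𝒟 : 𝒟.HasDPI) (P Q : Measure (X × Y))
    [IsFiniteMeasure P] [IsFiniteMeasure Q] :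
    𝒟.D Y (P.map Prod.snd) (Q.map Prod.snd) ≤ 𝒟.D (X × Y) P Q := by
  simpa only [Measure.deterministic_comp_eq_map] using
    h𝒟 (X × Y) Y (Kernel.deterministic Prod.snd measurable_snd) P Q

theorem Divergence.HasDPI.mix_le {𝒟 : Divergence} (h𝒟 : 𝒟.HasDPI) (P Q : Measure Y)
    [IsFiniteMeasure P] [IsFiniteMeasure Q] (L : Kernel Y X) [IsMarkovKernel L] :
    𝒟.D (X × Y) (mix P L) (mix Q L) ≤ 𝒟.D Y P Q := by
  have := Kernel.IsMarkovKernel.map (Kernel.id ×ₖ L) (measurable_swap (α := Y) (β := X))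
  simpa only [mix_eq_bind] using h𝒟 Y (X × Y) ((Kernel.id ×ₖ L).map Prod.swap) P Q

theorem IsPropResponse.mem_plansSnd_and_divergence_le {E : Set (X × Y)} (hE : MeasurableSet E)
    {νY : Measure Y} [IsFiniteMeasure νY] {π π' : Measure (X × Y)} [IsFiniteMeasure π]
    (hπE : π Eᶜ = 0) (h : IsPropResponse E νY π π') {𝒟 : Divergence} (h𝒟 : 𝒟.HasDPI) :
    π' ∈ PlansSnd E νY ∧ 𝒟.D (X × Y) π π' ≤ 𝒟.D Y (π.map Prod.snd) νY := by
  obtain ⟨L, hL, hπ, hπ', hπ'E⟩ := h.exists_isMarkovKernel hE hπE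
  refine ⟨⟨?_, hπ'E, hπ' ▸ map_snd_mix νY L⟩, ?_⟩
  · rw [hπ', mix_eq_map_compProd]
    infer_instance
  · conv_lhs => rw [hπ, hπ']
    exact h𝒟.mix_le _ _ L

theorem paired_to_one_sided_reduction
    [TopologicalSpace X] [PolishSpace X] [BorelSpace X]
    [TopologicalSpace Y] [PolishSpace Y] [BorelSpace Y]
    (E : Set (X × Y)) (hE : IsClosed E)
    (νX : Measure X) (νY : Measure Y) [IsFiniteMeasure νX] [IsFiniteMeasure νY]
    (hνX : 0 < νX Set.univ) (hνY : 0 < νY Set.univ)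
    (hNbhdX : ∀ x : X, ∃ y : Y, (x, y) ∈ E) (hNbhdY : ∀ y : Y, ∃ x : X, (x, y) ∈ E)
    (𝒟 : Divergence) (h𝒟 : 𝒟.HasDPI) :
    sInf {d : EReal | ∃ πι ∈ Plans E νX, ∃ πῑ ∈ PlansSnd E νY, d = 𝒟.D (X × Y) πι πῑ}
        = sInf {d : EReal | ∃ π ∈ Plans E νX, d = 𝒟.D Y (π.map Prod.snd) νY} ∧
      (∀ πs ∈ Plans E νX,
        𝒟.D Y (πs.map Prod.snd) νY
            = sInf {d : EReal | ∃ π ∈ Plans E νX, d = 𝒟.D Y (π.map Prod.snd) νY} →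
        ∀ π' : Measure (X × Y), IsPropResponse E νY πs π' →
          𝒟.D (X × Y) πs π'
            = sInf {d : EReal | ∃ πι ∈ Plans E νX, ∃ πῑ ∈ PlansSnd E νY,
                d = 𝒟.D (X × Y) πι πῑ}) ∧
      (∀ πs ∈ Plans E νX, ∀ πs' ∈ PlansSnd E νY,
        𝒟.D (X × Y) πs πs'
            = sInf {d : EReal | ∃ πι ∈ Plans E νX, ∃ πῑ ∈ PlansSnd E νY,
                d = 𝒟.D (X × Y) πι πῑ} →
        𝒟.D Y (πs.map Prod.snd) νY
            = sInf {d : EReal | ∃ π ∈ Plans E νX, d = 𝒟.D Y (π.map Prod.snd) νY}) := by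
  have : NeZero νY := ⟨fun h ↦ by simp [h] at hνY⟩
  have : Nonempty Y := νY.nonempty_of_neZero
  have hle (πι) (hι : πι ∈ Plans E νX) (πῑ) (hῑ : πῑ ∈ PlansSnd E νY) :
      𝒟.D Y (πι.map Prod.snd) νY ≤ 𝒟.D (X × Y) πι πῑ := by
    have := hι.1
    have := hῑ.1
    simpa only [hῑ.2.2] using h𝒟.map_snd_le πι πῑ
  have hresp (π) (hπ : π ∈ Plans E νX) (π') (h : IsPropResponse E νY π π') :
      π' ∈ PlansSnd E νY ∧ 𝒟.D (X × Y) π π' ≤ 𝒟.D Y (π.map Prod.snd) νY := by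
    have := hπ.1
    exact h.mem_plansSnd_and_divergence_le hE.measurableSet hπ.2.1 h𝒟
  have heq : sInf {d : EReal | ∃ πι ∈ Plans E νX, ∃ πῑ ∈ PlansSnd E νY, d = 𝒟.D (X × Y) πι πῑ}
      = sInf {d : EReal | ∃ π ∈ Plans E νX, d = 𝒟.D Y (π.map Prod.snd) νY} := by
    refine le_antisymm (le_sInf ?_) (le_sInf ?_)
    · rintro _ ⟨π, hπ, rfl⟩
      have := hπ.1
      obtain ⟨π', hπ'⟩ := exists_isPropResponse hE hNbhdY νY π
      exact sInf_le_of_le ⟨π, hπ, π', (hresp π hπ π' hπ').1, rfl⟩ (hresp π hπ π' hπ').2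
    · rintro _ ⟨πι, hι, πῑ, hῑ, rfl⟩
      exact sInf_le_of_le ⟨πι, hι, rfl⟩ (hle πι hι πῑ hῑ)
  refine ⟨heq, fun πs hπs hopt π' hπ' ↦ ?_, fun πs hπs πs' hπs' hopt ↦ ?_⟩
  · obtain ⟨hmem, hD⟩ := hresp πs hπs π' hπ'
    exact le_antisymm (hD.trans (hopt.trans heq.symm).le) (sInf_le ⟨πs, hπs, π', hmem, rfl⟩)
  · exact le_antisymm ((hle πs hπs πs' hπs').trans (hopt.trans heq).le) (sInf_le ⟨πs, hπs, rfl⟩)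
end
end

section
/- Let Ω be a standard Borel space and let A, B be collections of finite Borel measures on Ω such that there exist constants a, b > 0 with x(Ω) = a for every x ∈ A and y(Ω) = b for every y ∈ B. Suppose (x*, y*) ∈ A × B satisfies HS_γ(x*‖y*) = inf{HS_γ(x‖y) : (x,y) ∈ A × B} for every γ > 0. Then for every divergence D satisfying channel-DPI, D(x*‖y*) = inf{D(x‖y) : (x,y) ∈ A × B}. -/
/- STATEMENT 1: Hockey-stick universality implies universality for all divergences
satisfying the channel data-processing inequality (Proposition `HS_implies_DPI`). -/

open MeasureTheory ProbabilityTheory Filter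
open scoped ENNReal NNReal

noncomputable section

/-- The nonnegative part of an extended real number, as an element of `ℝ≥0∞`. -/
def erealToENNReal (a : EReal) : ℝ≥0∞ :=
  if a = ⊤ then ⊤ else ENNReal.ofReal a.toReal

/-- Extended-real integral via positive/negative parts. -/
def erealIntegral {Ω : Type} [MeasurableSpace Ω] (μ : Measure Ω) (f : Ω → EReal) : EReal :=
  ((∫⁻ x, erealToENNReal (f x) ∂μ : ℝ≥0∞) : EReal)
    - ((∫⁻ x, erealToENNReal (-f x) ∂μ : ℝ≥0∞) : EReal)

/-- Recession slope of `θ`, i.e. `lim_{t → ∞} θ t / t`. -/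
def recessionSlope (θ : ℝ → EReal) : EReal :=
  Filter.limsup (fun t : ℝ => θ t * ((t⁻¹ : ℝ) : EReal)) Filter.atTop

/-- The `θ`-divergence `D_θ(P‖Q) = ∫ θ(dP_ac/dQ) dQ + θ'_∞ · P⊥(Ω)`. -/
def thetaDiv {Ω : Type} [MeasurableSpace Ω] (θ : ℝ → EReal) (P Q : Measure Ω) : EReal :=
  erealIntegral Q (fun x => θ ((P.rnDeriv Q x).toReal))
    + recessionSlope θ * ((P.singularPart Q Set.univ : ℝ≥0∞) : EReal)

/-- The hockey-stick divergence `HS_γ`. -/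
def hsDiv {Ω : Type} [MeasurableSpace Ω] (γ : ℝ) (P Q : Measure Ω) : EReal :=
  thetaDiv (fun t => ((max (t - γ) 0 : ℝ) : EReal)) P Q

/-- A linear functional that is nonnegative on the preimage of the nonnegative continuous functions
under `T` is integration of `T w` against a finite measure. -/
lemma exists_measure_of_nonneg {X W : Type*} [TopologicalSpace X] [CompactSpace X] [T2Space X]
    [MeasurableSpace X] [BorelSpace X] [AddCommGroup W] [Module ℝ W]
    (T : W →ₗ[ℝ] C(X, ℝ)) (L : W →ₗ[ℝ] ℝ) (w₁ : W) (hw₁ : T w₁ = 1)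
    (hpos : ∀ w, 0 ≤ T w → 0 ≤ L w) :
    ∃ π : Measure X, IsFiniteMeasure π ∧ ∀ w, ∫ x, T w x ∂π = L w := by
  let s : PointedCone ℝ (C(X, ℝ) × W) :=
    (PointedCone.positive ℝ C(X, ℝ)).comap (LinearMap.fst ℝ _ _ + T ∘ₗ LinearMap.snd ℝ _ _)
  have hs : ∀ p, p ∈ s ↔ 0 ≤ p.1 + T p.2 := fun p ↦ by simp [s]
  let f : C(X, ℝ) × W →ₗ.[ℝ] ℝ :=
    ⟨LinearMap.ker (LinearMap.fst ℝ C(X, ℝ) W),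
      (L ∘ₗ LinearMap.snd ℝ _ _) ∘ₗ Submodule.subtype _⟩
  obtain ⟨g, hg, hgs⟩ := riesz_extension s f (by
      rintro ⟨⟨F, w⟩, hF⟩ hx
      have hF' : F = 0 := hF
      subst hF'
      exact hpos w (by simpa using (hs _).1 hx)) (by
      rintro ⟨F, w⟩
      refine ⟨⟨(0, ‖F‖ • w₁ - w), rfl⟩, (hs _).2 ?_⟩
      intro x
      have h1 := (abs_le.1 (F.norm_coe_le_norm x)).1
      simp [hw₁]
      linarith)
  have hgL : ∀ w, g (T w, 0) = L w := fun w ↦ by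
    have h1 := hgs (T w, -w) ((hs _).2 (by simp only [map_neg, add_neg_cancel, le_refl]))
    have h2 := hgs (-T w, w) ((hs _).2 (by simp only [neg_add_cancel, le_refl]))
    have h3 : g (0, w) = L w := hg ⟨(0, w), rfl⟩
    have h4 : g (T w, -w) = g (T w, 0) - g (0, w) := by rw [← map_sub]; simp
    have h5 : g (-T w, w) = g (0, w) - g (T w, 0) := by rw [← map_sub]; simp
    linarith
  let Λ₀ : CompactlySupportedContinuousMap X ℝ →ₗ[ℝ] ℝ :=
    { toFun := fun F ↦ g (F.toContinuousMap, 0)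
      map_add' := fun F G ↦ by rw [← map_add]; congr 1; ext <;> simp
      map_smul' := fun c F ↦ by
        rw [RingHom.id_apply, ← map_smul]; congr 1; ext <;> simp }
  let Λ : CompactlySupportedContinuousMap X ℝ →ₚ[ℝ] ℝ := PositiveLinearMap.mk₀ Λ₀ fun F hF ↦
    hgs _ ((hs _).2 (by
      rw [map_zero, add_zero]
      exact fun x ↦ hF x))
  refine ⟨RealRMK.rieszMeasure Λ, ?_, fun w ↦ ?_⟩
  · constructor
    exact isCompact_univ.measure_lt_top
  · rw [← hgL]
    exact RealRMK.integral_rieszMeasure Λ (CompactlySupportedContinuousMap.continuousMapEquiv (T w))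

/-- If hockey-stick integrals are ordered, so are integrals of Lipschitz convex functions. -/
lemma integral_le_integral_of_hockeyStick {m' m : Measure unitInterval}
    [IsFiniteMeasure m'] [IsFiniteMeasure m] (h0 : m'.real Set.univ = m.real Set.univ)
    (h1 : ∫ t, (t : ℝ) ∂m' = ∫ t, (t : ℝ) ∂m)
    (hc : ∀ c : ℝ, 0 < c → c < 1 →
      ∫ t, max ((t : ℝ) - c) 0 ∂m' ≤ ∫ t, max ((t : ℝ) - c) 0 ∂m)
    {φ : ℝ → ℝ} {M : ℝ} (hL : ∀ x y, φ x - φ y ≤ M * |x - y|)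
    (hφ : Continuous φ) (hconv : ∀ y d, 2 * φ y ≤ φ (y - d) + φ (y + d)) :
    ∫ t, φ t ∂m' ≤ ∫ t, φ t ∂m := by
  have hint : ∀ (ν : Measure unitInterval) [IsFiniteMeasure ν] (ψ : ℝ → ℝ), Continuous ψ →
      Integrable (fun t : unitInterval ↦ ψ t) ν := fun ν _ ψ hψ ↦
    (hψ.comp continuous_subtype_val).integrable_of_hasCompactSupport
      (HasCompactSupport.of_compactSpace _)
  have hM : 0 ≤ M := by
    have h2 := hL 1 0
    have h3 := hL 0 1
    norm_num at h2 h3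
    linarith
  have hc' : ∀ c : ℝ, 0 < c →
      ∫ t, max ((t : ℝ) - c) 0 ∂m' ≤ ∫ t, max ((t : ℝ) - c) 0 ∂m := by
    intro c hc0
    rcases lt_or_ge c 1 with h | h
    · exact hc c hc0 h
    · have : ∀ t : unitInterval, max ((t : ℝ) - c) 0 = 0 := fun t ↦
        max_eq_right (by linarith [t.2.2])
      simp [this]
  have key : ∀ δ : ℝ, 0 < δ → ∀ k : ℕ, ∃ ψ : ℝ → ℝ, Continuous ψ ∧
      ∫ t, ψ t ∂m' ≤ ∫ t, ψ t ∂m ∧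
      (∀ t, 0 ≤ t → t ≤ (k + 1) * δ → |ψ t - φ t| ≤ 2 * M * δ) ∧
      ∀ t, k * δ ≤ t → ψ t = φ (k * δ) + (φ ((k + 1) * δ) - φ (k * δ)) / δ * (t - k * δ) := by
    intro δ hδ
    have haff : ∀ z t, z ≤ t → t ≤ z + δ →
        |φ z + (φ (z + δ) - φ z) / δ * (t - z) - φ t| ≤ 2 * M * δ := by
      intro z t hz ht
      have a1 := hL z t
      have a2 := hL t z
      have a3 := hL z (z + δ)
      have a4 := hL (z + δ) z
      rw [abs_sub_comm, abs_of_nonneg (by linarith)] at a1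
      rw [abs_of_nonneg (by linarith)] at a2
      rw [abs_sub_comm, abs_of_nonneg (by linarith)] at a3
      rw [abs_of_nonneg (by linarith)] at a4
      have b1 : M * (t - z) ≤ M * δ := mul_le_mul_of_nonneg_left (by linarith) hM
      have b2 : |(φ (z + δ) - φ z) / δ * (t - z)| ≤ M * δ := by
        rw [abs_mul, abs_of_nonneg (show 0 ≤ t - z by linarith)]
        have : |(φ (z + δ) - φ z) / δ| ≤ M := by
          rw [abs_div, abs_of_pos hδ, div_le_iff₀ hδ, abs_le]
          constructor <;> linarith
        exact (mul_le_mul_of_nonneg_right this (by linarith)).trans b1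
      rw [abs_le] at b2 ⊢
      constructor <;> linarith
    intro k
    induction k with
    | zero =>
      refine ⟨fun t ↦ φ 0 + (φ δ - φ 0) / δ * t, by fun_prop, ?_, ?_, ?_⟩
      · rw [integral_add (integrable_const _) (hint _ (fun t ↦ _ * t) (by fun_prop)),
          integral_add (integrable_const _) (hint _ (fun t ↦ _ * t) (by fun_prop)),
          integral_const_mul, integral_const_mul, h1]
        simp [h0]
      · intro t ht0 ht1
        have := haff 0 t ht0 (by simpa using ht1)
        simpa using this
      · simp
    | succ k ih =>
      obtain ⟨ψ, hψc, hψi, hψa, hψe⟩ := ih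
      set z := ((k + 1 : ℕ) : ℝ) * δ with hz
      have hz1 : (k : ℝ) * δ = z - δ := by rw [hz]; push_cast; ring
      have hz2 : ((k : ℝ) + 1) * δ = z := by rw [hz]; push_cast; ring
      have hz3 : (((k + 1 : ℕ) : ℝ) + 1) * δ = z + δ := by rw [hz]; ring
      have hzpos : 0 < z := by positivity
      rw [hz2] at hψa
      simp only [hz1, hz2] at hψe
      rw [hz3]
      set w := (φ (z + δ) - φ z) / δ - (φ z - φ (z - δ)) / δ with hw
      have hw0 : 0 ≤ w := by
        rw [hw, ← sub_div]
        exact div_nonneg (by linarith [hconv z δ]) hδ.le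
      have hE : ∀ t, z ≤ t → ψ t + w * max (t - z) 0 = φ z + (φ (z + δ) - φ z) / δ * (t - z) := by
        intro t ht
        rw [max_eq_left (by linarith), hψe t (by linarith), hw]
        field_simp
        ring
      refine ⟨fun t ↦ ψ t + w * max (t - z) 0, by fun_prop, ?_, ?_, hE⟩
      · rw [integral_add (hint _ ψ hψc) (hint _ (fun t ↦ w * max (t - z) 0) (by fun_prop)),
          integral_add (hint _ ψ hψc) (hint _ (fun t ↦ w * max (t - z) 0) (by fun_prop)),
          integral_const_mul, integral_const_mul]
        exact add_le_add hψi (mul_le_mul_of_nonneg_left (hc' z hzpos) hw0)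
      · intro t ht0 ht1
        rcases le_total t z with h | h
        · simpa [max_eq_right (sub_nonpos.2 h)] using hψa t ht0 h
        · simp only [hE t h]
          exact haff z t h ht1
  have hN : ∀ N : ℕ, ∫ t, φ t ∂m' ≤
      ∫ t, φ t ∂m + 4 * M * m.real Set.univ * (1 / ((N : ℝ) + 1)) := by
    intro N
    have hpos : (0 : ℝ) < 1 / ((N : ℝ) + 1) := by positivity
    obtain ⟨ψ, hψc, hψi, hψa, -⟩ := key _ hpos N
    set δ := 1 / ((N : ℝ) + 1) with hδ
    have hd : ((N : ℝ) + 1) * δ = 1 := by rw [hδ]; field_simp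
    have hb : ∀ t : unitInterval, |ψ t - φ t| ≤ 2 * M * δ := fun t ↦
      hψa t t.2.1 (by rw [hd]; exact t.2.2)
    have i1 : ∫ t, φ t ∂m' ≤ ∫ t : unitInterval, (ψ t + 2 * M * δ) ∂m' :=
      integral_mono (hint _ φ hφ) (hint _ (fun t ↦ ψ t + 2 * M * δ) (by fun_prop)) fun t ↦ by
        have := (abs_le.1 (hb t)).1
        simp only
        linarith
    have i2 : ∫ t : unitInterval, ψ t ∂m ≤ ∫ t : unitInterval, (φ t + 2 * M * δ) ∂m :=
      integral_mono (hint _ ψ hψc) (hint _ (fun t ↦ φ t + 2 * M * δ) (by fun_prop)) fun t ↦ by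
        have := (abs_le.1 (hb t)).2
        simp only
        linarith
    rw [integral_add (hint _ _ (by fun_prop)) (integrable_const _)] at i1 i2
    simp only [integral_const, smul_eq_mul, h0] at i1 i2
    linarith
  have hlim := (tendsto_one_div_add_atTop_nhds_zero_nat (𝕜 := ℝ)).const_mul
    (4 * M * m.real Set.univ)
  rw [mul_zero] at hlim
  have := ge_of_tendsto' (hlim.const_add (∫ t, φ t ∂m)) hN
  simpa using this

/-- **Strassen's theorem** on the unit interval: if the hockey-stick integrals of `m'` are dominated
by those of `m`, then there is a martingale coupling of `m'` and `m`. -/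
lemma exists_martingale_coupling {m' m : Measure unitInterval}
    [IsFiniteMeasure m'] [IsFiniteMeasure m] (h0 : m'.real Set.univ = m.real Set.univ)
    (h1 : ∫ t, (t : ℝ) ∂m' = ∫ t, (t : ℝ) ∂m)
    (hc : ∀ c : ℝ, 0 < c → c < 1 →
      ∫ t, max ((t : ℝ) - c) 0 ∂m' ≤ ∫ t, max ((t : ℝ) - c) 0 ∂m) :
    ∃ π : Measure (unitInterval × unitInterval), IsFiniteMeasure π ∧ π.fst = m' ∧ π.snd = m ∧
      ∀ h : C(unitInterval, ℝ), ∫ p, h p.1 * ((p.2 : ℝ) - p.1) ∂π = 0 := by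
  have hint : ∀ (ν : Measure unitInterval) [IsFiniteMeasure ν] (g : C(unitInterval, ℝ)),
      Integrable g ν := fun ν _ g ↦
    g.continuous.integrable_of_hasCompactSupport (HasCompactSupport.of_compactSpace _)
  let T : (C(unitInterval, ℝ) × C(unitInterval, ℝ) × C(unitInterval, ℝ)) →ₗ[ℝ]
      C(unitInterval × unitInterval, ℝ) :=
    { toFun := fun w ↦ ⟨fun p ↦ w.1 p.1 + w.2.1 p.1 * ((p.2 : ℝ) - p.1) + w.2.2 p.2, by fun_prop⟩
      map_add' := fun w w' ↦ by ext p; simp; ring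
      map_smul' := fun c w ↦ by ext p; simp; ring }
  let L : (C(unitInterval, ℝ) × C(unitInterval, ℝ) × C(unitInterval, ℝ)) →ₗ[ℝ] ℝ :=
    { toFun := fun w ↦ ∫ t, w.1 t ∂m' + ∫ t, w.2.2 t ∂m
      map_add' := fun w w' ↦ by
        simp only [Prod.fst_add, Prod.snd_add, ContinuousMap.add_apply]
        rw [integral_add (hint _ _) (hint _ _), integral_add (hint _ _) (hint _ _)]
        ring
      map_smul' := fun c w ↦ by
        simp [integral_const_mul, mul_add] }
  obtain ⟨π, hπ, hπT⟩ := exists_measure_of_nonneg T L (1, 0, 0) (by ext p; simp [T]) (by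
    rintro ⟨u, h, g⟩ hw
    have hw' : ∀ x y : unitInterval, 0 ≤ u x + h x * ((y : ℝ) - x) + g y := fun x y ↦ hw (x, y)
    let φ : ℝ → ℝ := fun y ↦ ⨆ x : unitInterval, (-u x - h x * (y - x))
    have hbdd : ∀ y, BddAbove (Set.range fun x : unitInterval ↦ -u x - h x * (y - x)) := fun y ↦
      (isCompact_range (by fun_prop)).bddAbove
    have hle : ∀ (x : unitInterval) y, -u x - h x * (y - x) ≤ φ y := fun x y ↦
      le_ciSup (hbdd y) x
    have hL : ∀ y z, φ y - φ z ≤ ‖h‖ * |y - z| := by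
      intro y z
      rw [sub_le_iff_le_add]
      refine ciSup_le fun x ↦ ?_
      have a1 := hle x z
      have a2 : -h x * (y - z) ≤ ‖h‖ * |y - z| := by
        refine (le_abs_self _).trans ?_
        rw [abs_mul, abs_neg]
        exact mul_le_mul_of_nonneg_right (h.norm_coe_le_norm x) (abs_nonneg _)
      linarith
    have hφ : Continuous φ := by
      refine (LipschitzWith.of_dist_le_mul (K := ‖h‖₊) fun y z ↦ ?_).continuous
      rw [Real.dist_eq, Real.dist_eq, abs_le, coe_nnnorm]
      have := hL y z
      have := hL z y
      rw [abs_sub_comm] at this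
      constructor <;> linarith
    have hφ' : ∀ (ν : Measure unitInterval) [IsFiniteMeasure ν],
        Integrable (fun t : unitInterval ↦ φ t) ν := fun ν _ ↦
      hint ν ⟨fun t ↦ φ t, by fun_prop⟩
    have hmain := integral_le_integral_of_hockeyStick h0 h1 hc hL hφ fun y d ↦ by
      rw [← le_div_iff₀' (by norm_num)]
      refine ciSup_le fun x ↦ ?_
      have := hle x (y - d)
      have := hle x (y + d)
      linarith
    have i1 : ∫ t, -u t ∂m' ≤ ∫ t : unitInterval, φ t ∂m' :=
      integral_mono (hint _ (-u)) (hφ' _) fun t ↦ by simpa using hle t t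
    have i2 : ∫ t : unitInterval, φ t ∂m ≤ ∫ t, g t ∂m :=
      integral_mono (hφ' _) (hint _ g) fun t ↦ ciSup_le fun x ↦ by linarith [hw' x t]
    rw [integral_neg] at i1
    change 0 ≤ ∫ t, u t ∂m' + ∫ t, g t ∂m
    linarith)
  refine ⟨π, hπ, ?_, ?_, fun h ↦ ?_⟩
  · refine ext_of_forall_integral_eq_of_IsFiniteMeasure fun g ↦ ?_
    rw [Measure.fst, integral_map (by fun_prop) (g.continuous.aestronglyMeasurable)]
    simpa [T, L] using hπT (g.toContinuousMap, 0, 0)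
  · refine ext_of_forall_integral_eq_of_IsFiniteMeasure fun g ↦ ?_
    rw [Measure.snd, integral_map (by fun_prop) (g.continuous.aestronglyMeasurable)]
    simpa [T, L] using hπT (0, 0, g.toContinuousMap)
  · simpa [T, L] using hπT (0, h, 0)

lemma lintegral_mul_snd_eq_lintegral_mul_fst {π : Measure (unitInterval × unitInterval)}
    [IsFiniteMeasure π] (hπ : ∀ h : C(unitInterval, ℝ), ∫ p, h p.1 * ((p.2 : ℝ) - p.1) ∂π = 0)
    {G : unitInterval → ℝ≥0∞} (hG : Measurable G) :
    ∫⁻ p, ENNReal.ofReal p.2 * G p.1 ∂π = ∫⁻ p, ENNReal.ofReal p.1 * G p.1 ∂π := by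
  have hfin : ∀ w : unitInterval × unitInterval → unitInterval,
      IsFiniteMeasure (π.withDensity fun p ↦ ENNReal.ofReal (w p)) := fun w ↦ by
    refine isFiniteMeasure_withDensity (ne_top_of_le_ne_top (measure_ne_top π Set.univ) ?_)
    rw [← lintegral_one]
    exact lintegral_mono fun p ↦ ENNReal.ofReal_le_one.2 (w p).2.2
  have := hfin Prod.fst
  have := hfin Prod.snd
  have hint : ∀ f : unitInterval × unitInterval → ℝ, Continuous f → Integrable f π := fun f hf ↦
    hf.integrable_of_hasCompactSupport (HasCompactSupport.of_compactSpace _)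
  have hE : (π.withDensity fun p ↦ ENNReal.ofReal p.2).map Prod.fst =
      (π.withDensity fun p ↦ ENNReal.ofReal p.1).map Prod.fst := by
    refine ext_of_forall_integral_eq_of_IsFiniteMeasure fun g ↦ ?_
    rw [integral_map (by fun_prop) (g.continuous.aestronglyMeasurable),
      integral_map (by fun_prop) (g.continuous.aestronglyMeasurable),
      integral_withDensity_eq_integral_toReal_smul (by fun_prop) (by simp),
      integral_withDensity_eq_integral_toReal_smul (by fun_prop) (by simp), ← sub_eq_zero,
      ← integral_sub, ← hπ g.toContinuousMap]
    · congr 1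
      ext p
      simp [ENNReal.toReal_ofReal p.1.2.1, ENNReal.toReal_ofReal p.2.2.1]
      ring
    all_goals
      simp only [ENNReal.toReal_ofReal (unitInterval.nonneg _), smul_eq_mul]
      exact hint _ (by fun_prop)
  have := congrArg (fun ν ↦ ∫⁻ t, G t ∂ν) hE
  rwa [lintegral_map hG measurable_fst, lintegral_map hG measurable_fst,
    lintegral_withDensity_eq_lintegral_mul _ (by fun_prop) (by fun_prop),
    lintegral_withDensity_eq_lintegral_mul _ (by fun_prop) (by fun_prop)] at this

/-- Composing a likelihood statistic with the reversed martingale coupling and the conditional law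
given the target likelihood transports all measures with density depending on the likelihood. -/
lemma exists_kernel_bind_withDensity {X Y : Type*} [MeasurableSpace X] [MeasurableSpace Y]
    [StandardBorelSpace Y] [Nonempty Y] {μ : Measure X} {μ' : Measure Y} [IsFiniteMeasure μ]
    [IsFiniteMeasure μ'] {f : X → unitInterval} {f' : Y → unitInterval} (hf : Measurable f)
    (hf' : Measurable f') {π : Measure (unitInterval × unitInterval)} [IsFiniteMeasure π]
    (hπ₁ : π.fst = μ'.map f') (hπ₂ : π.snd = μ.map f) :
    ∃ K : Kernel X Y, IsMarkovKernel K ∧ ∀ w : unitInterval → ℝ≥0∞, Measurable w →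
      (∀ G : unitInterval → ℝ≥0∞, Measurable G →
        ∫⁻ p, w p.2 * G p.1 ∂π = ∫⁻ p, w p.1 * G p.1 ∂π) →
      (μ.withDensity (w ∘ f)).bind K = μ'.withDensity (w ∘ f') := by
  let κ : Kernel unitInterval unitInterval := (π.map Prod.swap).condKernel
  let ρ : Kernel unitInterval Y := condDistrib id f' μ'
  have hκ : μ.map f ⊗ₘ κ = π.map Prod.swap := by
    rw [← hπ₂, ← Measure.fst_map_swap]
    exact (π.map Prod.swap).disintegrate _
  have hρ : μ'.map f' ⊗ₘ ρ = μ'.map fun y ↦ (f' y, y) :=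
    compProd_map_condDistrib measurable_id.aemeasurable
  refine ⟨(ρ ∘ₖ κ).comap f hf, inferInstance, fun w hw hwG ↦ ?_⟩
  ext B hB
  have hρB : Measurable fun s ↦ ρ s B := ρ.measurable_coe hB
  calc (μ.withDensity (w ∘ f)).bind ((ρ ∘ₖ κ).comap f hf) B
      = ∫⁻ x, w (f x) * ((ρ ∘ₖ κ) (f x) B) ∂μ := by
        rw [Measure.bind_apply hB (Kernel.aemeasurable _),
          lintegral_withDensity_eq_lintegral_mul _ (hw.comp hf) (Kernel.measurable_coe _ hB)]
        rfl
    _ = ∫⁻ t, w t * ((ρ ∘ₖ κ) t B) ∂(μ.map f) := by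
        have := (ρ ∘ₖ κ).measurable_coe hB
        rw [lintegral_map (by fun_prop) hf]
    _ = ∫⁻ t, ∫⁻ s, w t * ρ s B ∂(κ t) ∂(μ.map f) := by
        refine lintegral_congr fun t ↦ ?_
        rw [Kernel.comp_apply' _ _ _ hB, lintegral_const_mul _ hρB]
    _ = ∫⁻ p, w p.1 * ρ p.2 B ∂(μ.map f ⊗ₘ κ) := by
        rw [Measure.lintegral_compProd (by fun_prop)]
    _ = ∫⁻ p, w p.2 * ρ p.1 B ∂π := by
        rw [hκ, lintegral_map (by fun_prop) measurable_swap]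
        rfl
    _ = ∫⁻ p, w p.1 * ρ p.1 B ∂π := hwG _ hρB
    _ = ∫⁻ s, w s * ρ s B ∂(μ'.map f') := by
        rw [← hπ₁, Measure.fst, lintegral_map (by fun_prop) measurable_fst]
    _ = ∫⁻ p, w p.1 * B.indicator 1 p.2 ∂(μ'.map f' ⊗ₘ ρ) := by
        have : Measurable (B.indicator (1 : Y → ℝ≥0∞)) := measurable_one.indicator hB
        rw [Measure.lintegral_compProd (by fun_prop)]
        refine lintegral_congr fun s ↦ ?_
        simp only
        rw [lintegral_const_mul _ this, lintegral_indicator_one hB]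
    _ = ∫⁻ y, B.indicator (fun y ↦ w (f' y)) y ∂μ' := by
        have : Measurable (B.indicator (1 : Y → ℝ≥0∞)) := measurable_one.indicator hB
        rw [hρ, lintegral_map (by fun_prop) (by fun_prop)]
        refine lintegral_congr fun y ↦ ?_
        by_cases hy : y ∈ B <;> simp [hy]
    _ = μ'.withDensity (w ∘ f') B := by
        rw [withDensity_apply _ hB, lintegral_indicator hB]
        rfl

lemma recessionSlope_hockeyStick (γ : ℝ) :
    recessionSlope (fun t ↦ ((max (t - γ) 0 : ℝ) : EReal)) = 1 := by
  have h1 : Tendsto (fun t : ℝ ↦ 1 - γ * t⁻¹) atTop (nhds 1) := by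
    simpa using (tendsto_inv_atTop_zero.const_mul γ).const_sub 1
  have h2 : Tendsto (fun t : ℝ ↦ ((1 - γ * t⁻¹ : ℝ) : EReal)) atTop (nhds ((1 : ℝ) : EReal)) :=
    (continuous_coe_real_ereal.tendsto _).comp h1
  refine (h2.congr' ?_).limsup_eq
  filter_upwards [eventually_gt_atTop 0, eventually_ge_atTop γ] with t ht htγ
  rw [max_eq_left (by linarith), ← EReal.coe_mul]
  congr 1
  field_simp

lemma hsDiv_eq {X : Type} [MeasurableSpace X] (γ : ℝ) (P Q : Measure X) :
    hsDiv γ P Q = ((∫⁻ x, ENNReal.ofReal ((P.rnDeriv Q x).toReal - γ) ∂Q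
      + P.singularPart Q Set.univ : ℝ≥0∞) : EReal) := by
  have h1 : ∀ a : ℝ, erealToENNReal ((max a 0 : ℝ) : EReal) = ENNReal.ofReal a := fun a ↦ by
    simp only [erealToENNReal, EReal.coe_ne_top, if_false, EReal.toReal_coe]
    rcases le_total a 0 with h | h
    · simp [h, ENNReal.ofReal_of_nonpos]
    · simp [h]
  have h2 : ∀ a : ℝ, erealToENNReal (-((max a 0 : ℝ) : EReal)) = 0 := fun a ↦ by
    rw [← EReal.coe_neg]
    simp [erealToENNReal, ENNReal.ofReal_eq_zero]
  simp only [hsDiv, thetaDiv, recessionSlope_hockeyStick, erealIntegral, h1, h2]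
  simp

/-- Two finite measures have densities `f` and `1 - f` with respect to their sum, and the
hockey-stick divergence is a hockey-stick integral of `f`. -/
lemma exists_likelihood {X : Type} [MeasurableSpace X] (P Q : Measure X) [IsFiniteMeasure P]
    [IsFiniteMeasure Q] :
    ∃ f : X → unitInterval, Measurable f ∧
      (P + Q).withDensity (fun x ↦ ENNReal.ofReal (f x)) = P ∧
      ∀ γ : ℝ, 0 < γ → hsDiv γ P Q =
        ((∫⁻ x, ENNReal.ofReal ((1 + γ) * f x - γ) ∂(P + Q) : ℝ≥0∞) : EReal) := by
  classical
  obtain ⟨S, hS, hPS, hQS⟩ := P.mutuallySingular_singularPart Q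
  set r : X → ℝ := fun x ↦ (P.rnDeriv Q x).toReal with hr
  have hrm : Measurable r := (P.measurable_rnDeriv Q).ennreal_toReal
  have hr0 : ∀ x, 0 ≤ r x := fun x ↦ ENNReal.toReal_nonneg
  have hrQ : Q.withDensity (fun x ↦ ENNReal.ofReal (r x)) = Q.withDensity (P.rnDeriv Q) := by
    refine withDensity_congr_ae ?_
    filter_upwards [P.rnDeriv_lt_top Q] with x hx
    exact ENNReal.ofReal_toReal hx.ne
  have hP : Q.withDensity (fun x ↦ ENNReal.ofReal (r x)) + P.singularPart Q = P := by
    rw [hrQ, P.rnDeriv_add_singularPart Q]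
  have hlint : ∀ g : X → ℝ≥0∞, Measurable g → ∫⁻ x, g x ∂P =
      ∫⁻ x, ENNReal.ofReal (r x) * g x ∂Q + ∫⁻ x, g x ∂(P.singularPart Q) := fun g hg ↦ by
    conv_lhs => rw [← hP]
    rw [lintegral_add_measure, lintegral_withDensity_eq_lintegral_mul _ (by fun_prop) hg]
    rfl
  have hlint' : ∀ g : X → ℝ≥0∞, Measurable g → ∫⁻ x, g x ∂(P + Q) =
      ∫⁻ x, ENNReal.ofReal (1 + r x) * g x ∂Q + ∫⁻ x, g x ∂(P.singularPart Q) := fun g hg ↦ by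
    rw [lintegral_add_measure, hlint g hg, add_right_comm, ← lintegral_add_left (by fun_prop)]
    congr 2
    ext x
    rw [ENNReal.ofReal_add zero_le_one (hr0 x), ENNReal.ofReal_one]
    ring
  let f : X → unitInterval := fun x ↦
    if x ∈ S then ⟨r x / (1 + r x), by have := hr0 x; positivity,
      (div_le_one (by have := hr0 x; positivity)).2 (by linarith)⟩ else 1
  have hf : Measurable f := by
    refine Measurable.ite hS (Measurable.subtype_mk ?_) measurable_const
    fun_prop
  have hfQ : ∀ᵐ x ∂Q, (f x : ℝ) = r x / (1 + r x) := by
    have : ∀ᵐ x ∂Q, x ∈ S := by rwa [ae_iff]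
    filter_upwards [this] with x hx
    simp [f, hx]
  have hfP : ∀ᵐ x ∂(P.singularPart Q), f x = 1 := by
    have : ∀ᵐ x ∂(P.singularPart Q), x ∉ S := by simpa [ae_iff] using hPS
    filter_upwards [this] with x hx
    simp [f, hx]
  refine ⟨f, hf, ?_, fun γ hγ ↦ ?_⟩
  · ext B hB
    rw [withDensity_apply _ hB, ← lintegral_indicator hB,
      hlint' _ ((by fun_prop : Measurable fun x ↦ ENNReal.ofReal (f x)).indicator hB),
      ← lintegral_indicator_one hB, hlint _ (measurable_one.indicator hB)]
    congr 1
    · refine lintegral_congr_ae ?_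
      filter_upwards [hfQ] with x hx
      by_cases hxB : x ∈ B
      · have := hr0 x
        simp only [Set.indicator_of_mem hxB, hx, Pi.one_apply, mul_one]
        rw [← ENNReal.ofReal_mul (by positivity)]
        congr 1
        field_simp
      · simp [hxB]
    · refine lintegral_congr_ae ?_
      filter_upwards [hfP] with x hx
      by_cases hxB : x ∈ B <;> simp [hxB, hx]
  · rw [hsDiv_eq, hlint' _ (by fun_prop)]
    congr 2
    · refine lintegral_congr_ae ?_
      filter_upwards [hfQ] with x hx
      have := hr0 x
      rw [← ENNReal.ofReal_mul (by positivity), hx]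
      congr 1
      field_simp
      ring
    · rw [← lintegral_one]
      refine lintegral_congr_ae ?_
      filter_upwards [hfP] with x hx
      simp [hx]

/-- **Blackwell's theorem** for pairs of finite measures on standard Borel spaces: domination of all
hockey-stick divergences implies the existence of a Markov kernel mapping one pair to the other. -/
lemma exists_kernel_of_hsDiv_le {X Y : Type} [MeasurableSpace X] [MeasurableSpace Y]
    [StandardBorelSpace Y] [Nonempty Y] (P Q : Measure X) (P' Q' : Measure Y) [IsFiniteMeasure P]
    [IsFiniteMeasure Q] [IsFiniteMeasure P'] [IsFiniteMeasure Q']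
    (hP : P' Set.univ = P Set.univ) (hQ : Q' Set.univ = Q Set.univ)
    (h : ∀ γ : ℝ, 0 < γ → hsDiv γ P' Q' ≤ hsDiv γ P Q) :
    ∃ K : Kernel X Y, IsMarkovKernel K ∧ P.bind K = P' ∧ Q.bind K = Q' := by
  obtain ⟨f, hf, hfP, hfH⟩ := exists_likelihood P Q
  obtain ⟨f', hf', hfP', hfH'⟩ := exists_likelihood P' Q'
  have hint : ∀ (ν : Measure unitInterval) [IsFiniteMeasure ν] (ψ : ℝ → ℝ), Continuous ψ →
      Integrable (fun t : unitInterval ↦ ψ t) ν := fun ν _ ψ hψ ↦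
    (hψ.comp continuous_subtype_val).integrable_of_hasCompactSupport
      (HasCompactSupport.of_compactSpace _)
  have hmass : ((P' + Q').map f').real Set.univ = ((P + Q).map f).real Set.univ := by
    simp [Measure.real, Measure.map_apply hf, Measure.map_apply hf', hP, hQ]
  have hmean : ∫ t, (t : ℝ) ∂((P' + Q').map f') = ∫ t, (t : ℝ) ∂((P + Q).map f) := by
    rw [integral_eq_lintegral_of_nonneg_ae (ae_of_all _ fun t ↦ t.2.1) (by fun_prop),
      integral_eq_lintegral_of_nonneg_ae (ae_of_all _ fun t ↦ t.2.1) (by fun_prop),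
      lintegral_map (by fun_prop) hf, lintegral_map (by fun_prop) hf',
      ← setLIntegral_univ, ← withDensity_apply _ .univ, hfP',
      ← setLIntegral_univ, ← withDensity_apply _ .univ, hfP, hP]
  have hhs : ∀ c : ℝ, 0 < c → c < 1 → ∫ t, max ((t : ℝ) - c) 0 ∂((P' + Q').map f') ≤
      ∫ t, max ((t : ℝ) - c) 0 ∂((P + Q).map f) := by
    intro c hc0 hc1
    have hc : 0 < 1 - c := by linarith
    set γ := c / (1 - c) with hγ
    have hγ0 : 0 < γ := div_pos hc0 hc
    have hle := h γ hγ0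
    rw [hfH γ hγ0, hfH' γ hγ0, EReal.coe_ennreal_le_coe_ennreal_iff] at hle
    have hscale : ∀ t : ℝ, ENNReal.ofReal ((1 + γ) * t - γ) =
        ENNReal.ofReal (1 + γ) * ENNReal.ofReal (max (t - c) 0) := fun t ↦ by
      rw [← ENNReal.ofReal_mul (by positivity), mul_max_of_nonneg _ _ (by positivity), mul_zero,
        ENNReal.ofReal_max, ENNReal.ofReal_zero, max_eq_left zero_le]
      congr 1
      rw [hγ]
      field_simp
      ring
    simp only [hscale] at hle
    rw [lintegral_const_mul _ (by fun_prop), lintegral_const_mul _ (by fun_prop),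
      ENNReal.mul_le_mul_iff_right (by simpa using by positivity) (by simp)] at hle
    have hnonneg : ∀ t : unitInterval, 0 ≤ max ((t : ℝ) - c) 0 := fun t ↦ le_max_right _ _
    rw [integral_eq_lintegral_of_nonneg_ae (ae_of_all _ hnonneg) (by fun_prop),
      integral_eq_lintegral_of_nonneg_ae (ae_of_all _ hnonneg) (by fun_prop)]
    refine ENNReal.toReal_mono ?_ ?_
    · exact (hint _ (fun t ↦ max (t - c) 0) (by fun_prop)).lintegral_lt_top.ne
    · rwa [lintegral_map (by fun_prop) hf, lintegral_map (by fun_prop) hf']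
  obtain ⟨π, hπ, hπ₁, hπ₂, hπm⟩ := exists_martingale_coupling hmass hmean hhs
  obtain ⟨K, hK, hKw⟩ := exists_kernel_bind_withDensity hf hf' hπ₁ hπ₂
  have hKP : P.bind K = P' := by
    have := hKw (fun t ↦ ENNReal.ofReal t) (by fun_prop)
      fun G hG ↦ lintegral_mul_snd_eq_lintegral_mul_fst hπm hG
    simpa only [Function.comp_def, hfP, hfP'] using this
  have hKsum : (P + Q).bind K = P' + Q' := by
    have := hKw (fun _ ↦ 1) measurable_const fun _ _ ↦ rfl
    simpa only [Function.comp_def, withDensity_const, one_smul] using this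
  refine ⟨K, hK, hKP, ?_⟩
  ext B hB
  have hB' := congrArg (fun ν ↦ ν B) hKsum
  have hB'' := congrArg (fun ν ↦ ν B) hKP
  simp only [Measure.bind_apply hB K.aemeasurable, lintegral_add_measure, Measure.add_apply]
    at hB' hB'' ⊢
  rw [hB''] at hB'
  exact (ENNReal.add_right_inj (measure_ne_top P' B)).1 hB'

theorem hs_universality_implies_dpi_universality
    {Ω : Type} [MeasurableSpace Ω] [StandardBorelSpace Ω]
    (A B : Set (Measure Ω))
    (a b : ℝ) (ha : 0 < a) (hb : 0 < b)
    (hA : ∀ x ∈ A, x Set.univ = ENNReal.ofReal a)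
    (hB : ∀ y ∈ B, y Set.univ = ENNReal.ofReal b)
    (xs ys : Measure Ω) (hxs : xs ∈ A) (hys : ys ∈ B)
    (hHS : ∀ γ : ℝ, 0 < γ →
      hsDiv γ xs ys = sInf {d : EReal | ∃ x ∈ A, ∃ y ∈ B, d = hsDiv γ x y})
    (𝒟 : Divergence) (h𝒟 : 𝒟.HasDPI) :
    𝒟.D Ω xs ys = sInf {d : EReal | ∃ x ∈ A, ∃ y ∈ B, d = 𝒟.D Ω x y} := by
  have hfin : ∀ (ν : Measure Ω) (c : ℝ), ν Set.univ = ENNReal.ofReal c → IsFiniteMeasure ν :=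
    fun ν c h ↦ ⟨by simp [h]⟩
  have := hfin xs a (hA xs hxs)
  have := hfin ys b (hB ys hys)
  have : Nonempty Ω := by
    by_contra hne
    rw [not_nonempty_iff] at hne
    have := hA xs hxs
    rw [Set.univ_eq_empty_iff.2 hne, measure_empty, eq_comm, ENNReal.ofReal_eq_zero] at this
    linarith
  refine le_antisymm (le_sInf ?_) (sInf_le ⟨xs, hxs, ys, hys, rfl⟩)
  rintro _ ⟨x, hx, y, hy, rfl⟩
  have := hfin x a (hA x hx)
  have := hfin y b (hB y hy)
  obtain ⟨K, hK, rfl, rfl⟩ := exists_kernel_of_hsDiv_le x y xs ys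
    ((hA xs hxs).trans (hA x hx).symm) ((hB ys hys).trans (hB y hy).symm) fun γ hγ ↦ by
      rw [hHS γ hγ]
      exact sInf_le ⟨x, hx, y, hy, rfl⟩
  exact h𝒟 Ω Ω K x y
end
end

section
/- Let Ω0 and Ω1 be standard Borel spaces, let E ⊆ Ω0 × Ω1 be a Borel measurable set, and let a, b be finite Borel measures on Ω0 and Ω1. Define F(a,b) := sup{σ(Ω0 × Ω1) : σ a finite measure on Ω0 × Ω1 with σ(Eᶜ) = 0, marginal on Ω0 at most a, and marginal on Ω1 at most b}. Then for every Borel set C ⊆ Ω0 the set N1(Cᶜ) := {y ∈ Ω1 : ∃ x ∈ Cᶜ, (x,y) ∈ E} is analytic, hence universally measurable; and F(a,b) = inf over Borel C ⊆ Ω0 of a(C) + b*(N1(Cᶜ)), where b* denotes the outer measure of b (equivalently, the value of the completion of b on this universally measurable set). -/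
/- STATEMENT 4: Measurable max-flow/min-cut duality on a bipartite relation
(Proposition `measurable_maxflow_mincut_bipartite`).  Standard Borel spaces are realized as
Polish spaces with their Borel σ-algebras.  Note that in Mathlib a measure applied to an
arbitrary set is its outer measure, so `b (N1 Cᶜ)` is the outer measure `b*` of that set. -/

open MeasureTheory ProbabilityTheory Filter
open scoped ENNReal NNReal

noncomputable section

/-- Every open neighbourhood of a compact subset of `ℕ → ℕ` contains a uniform cylinder
neighbourhood. -/
lemma IsCompact.exists_forall_cylinder_subset {K W : Set (ℕ → ℕ)} (hK : IsCompact K)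
    (hW : IsOpen W) (hKW : K ⊆ W) : ∃ n, ∀ τ ∈ K, PiNat.cylinder τ n ⊆ W := by
  refine hK.induction_on (p := fun S => ∃ n, ∀ τ ∈ S, PiNat.cylinder τ n ⊆ W) ⟨0, by simp⟩
    (fun s t hst ⟨n, hn⟩ => ⟨n, fun τ h => hn τ (hst h)⟩) ?_ ?_
  · rintro s t ⟨n, hn⟩ ⟨m, hm⟩
    refine ⟨max n m, ?_⟩
    rintro τ (h | h)
    · exact (PiNat.cylinder_anti τ (le_max_left n m)).trans (hn τ h)
    · exact (PiNat.cylinder_anti τ (le_max_right n m)).trans (hm τ h)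
  · intro x hx
    obtain ⟨_, ⟨y, n, rfl⟩, hxy, hsub⟩ :=
      (PiNat.isTopologicalBasis_cylinders (fun _ => ℕ)).exists_subset_of_mem_open (hKW hx) hW
    rw [← PiNat.mem_cylinder_iff_eq.1 hxy] at hsub
    refine ⟨PiNat.cylinder x n, mem_nhdsWithin_of_mem_nhds
      ((PiNat.isOpen_cylinder _ x n).mem_nhds (PiNat.self_mem_cylinder x n)), n, ?_⟩
    intro τ hτ
    rwa [PiNat.mem_cylinder_iff_eq.1 hτ]

/-- **Choquet's capacitability theorem** for analytic sets, for a capacity that is outer regular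
on compact sets. -/
theorem MeasureTheory.AnalyticSet.exists_isCompact_lt_of_capacity {X : Type*} [TopologicalSpace X]
    {T : Set X → ℝ≥0∞} (hmono : Monotone T)
    (hsup : ∀ A : ℕ → Set X, Monotone A → T (⋃ n, A n) ≤ ⨆ n, T (A n))
    (hout : ∀ K, IsCompact K → ∀ c, T K < c → ∃ U, IsOpen U ∧ K ⊆ U ∧ T U < c)
    {A : Set X} (hA : AnalyticSet A) {c : ℝ≥0∞} (hc : c < T A) :
    ∃ K, IsCompact K ∧ K ⊆ A ∧ c ≤ T K := by
  rw [AnalyticSet] at hA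
  obtain rfl | ⟨f, hf, rfl⟩ := hA
  · exact ⟨∅, isCompact_empty, subset_rfl, hc.le⟩
  let B : ℕ → (ℕ → ℕ) → Set (ℕ → ℕ) := fun n k => {σ | ∀ i < n, σ i ≤ k i}
  have step : ∀ n k, c < T (f '' B n k) → ∃ m, c < T (f '' B (n + 1) (Function.update k n m)) := by
    intro n k h
    have hU : f '' B n k ⊆ ⋃ m, f '' B (n + 1) (Function.update k n m) := by
      rintro _ ⟨σ, hσ, rfl⟩
      refine Set.mem_iUnion.2 ⟨σ n, σ, fun i hi => ?_, rfl⟩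
      rcases Nat.lt_succ_iff_lt_or_eq.1 hi with hi | rfl
      · rw [Function.update_of_ne hi.ne]; exact hσ i hi
      · simp
    have hM : Monotone fun m => f '' B (n + 1) (Function.update k n m) := by
      intro m m' hmm
      refine Set.image_mono fun σ hσ i hi => (hσ i hi).trans ?_
      by_cases hin : i = n
      · subst hin; simpa using hmm
      · simp [hin]
    exact lt_iSup_iff.1 (h.trans_le ((hmono hU).trans (hsup _ hM)))
  choose! m hm using step
  let κ : ℕ → ℕ → ℕ := fun n => Nat.rec 0 (fun n k => Function.update k n (m n k)) n
  have hκs : ∀ n, κ (n + 1) = Function.update (κ n) n (m n (κ n)) := fun n => rfl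
  have hκ : ∀ n, c < T (f '' B n (κ n)) := by
    intro n
    induction n with
    | zero =>
      have : B 0 (κ 0) = Set.univ := by ext; simp [B]
      rwa [this, Set.image_univ]
    | succ n ih => exact hm n _ ih
  let k : ℕ → ℕ := fun i => κ (i + 1) i
  have hκk : ∀ n, ∀ i < n, κ n i = k i := by
    intro n
    induction n with
    | zero => simp
    | succ n ih =>
      intro i hi
      rcases Nat.lt_succ_iff_lt_or_eq.1 hi with hi | rfl
      · rw [hκs, Function.update_of_ne hi.ne, ih i hi]
      · rfl
  have hk : ∀ n, c < T (f '' B n k) := by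
    intro n
    have : B n k = B n (κ n) := by
      ext σ
      exact forall₂_congr fun i hi => by rw [hκk n i hi]
    rw [this]; exact hκ n
  let K : Set (ℕ → ℕ) := Set.univ.pi fun i => Set.Iic (k i)
  have hK : IsCompact K := isCompact_univ_pi fun i => (Set.finite_Iic (k i)).isCompact
  refine ⟨f '' K, hK.image hf, Set.image_subset_range _ _, ?_⟩
  by_contra! hlt
  obtain ⟨U, hU, hKU, hTU⟩ := hout _ (hK.image hf) c hlt
  obtain ⟨n, hn⟩ := hK.exists_forall_cylinder_subset (hU.preimage hf) (Set.image_subset_iff.1 hKU)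
  refine absurd ((hk n).trans_le (hmono ?_)) hTU.not_gt
  rintro _ ⟨σ, hσ, rfl⟩
  refine hn (fun i => min (σ i) (k i)) (fun i _ => min_le_right (σ i) (k i)) fun i hi => ?_
  exact (min_eq_left (hσ i hi)).symm

/-- Analytic sets are universally measurable. -/
theorem MeasureTheory.AnalyticSet.nullMeasurableSet {X : Type*} [TopologicalSpace X]
    [PolishSpace X] [MeasurableSpace X] [BorelSpace X] {A : Set X} (hA : AnalyticSet A)
    (μ : Measure X) [IsFiniteMeasure μ] : NullMeasurableSet A μ := by
  let := TopologicalSpace.upgradeIsCompletelyMetrizable X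
  have key : ∀ c, c < μ A → ∃ K, IsCompact K ∧ K ⊆ A ∧ c ≤ μ K := fun c hc =>
    hA.exists_isCompact_lt_of_capacity (T := fun s => μ s) (fun s t h => measure_mono h)
      (fun A hA => hA.measure_iUnion.le)
      (fun K _ c h => by
        obtain ⟨U, h1, h2, h3⟩ := K.exists_isOpen_lt_of_lt c h
        exact ⟨U, h2, h1, h3⟩) hc
  rcases eq_or_ne (μ A) 0 with h0 | h0
  · exact NullMeasurableSet.of_null h0
  obtain ⟨u, -, hu, hlim⟩ := exists_seq_strictMono_tendsto' (pos_iff_ne_zero.2 h0)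
  choose K hK hKA hKu using fun n => key (u n) (hu n).2
  have hm : MeasurableSet (⋃ n, K n) := .iUnion fun n => (hK n).measurableSet
  have hsub : (⋃ n, K n) ⊆ A := Set.iUnion_subset hKA
  have hle : μ A ≤ μ (⋃ n, K n) :=
    le_of_tendsto' hlim fun n => (hKu n).trans (measure_mono (Set.subset_iUnion K n))
  exact (hm.nullMeasurableSet).congr
    (ae_eq_of_subset_of_measure_ge hsub hle hm.nullMeasurableSet (measure_ne_top μ A))

/-- The value of a minimal measurable cut of the relation `A`. -/
def cutValue {Ω0 Ω1 : Type*} [MeasurableSpace Ω0] [MeasurableSpace Ω1] (a : Measure Ω0)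
    (b : Measure Ω1) (A : Set (Ω0 × Ω1)) : ℝ≥0∞ :=
  ⨅ (C : Set Ω0) (D : Set Ω1) (_ : MeasurableSet C ∧ MeasurableSet D ∧
    ∀ z ∈ A, z.1 ∈ C ∨ z.2 ∈ D), a C + b D

section cutValue

variable {Ω0 Ω1 : Type*} [MeasurableSpace Ω0] [MeasurableSpace Ω1] {a : Measure Ω0}
  {b : Measure Ω1} {A : Set (Ω0 × Ω1)}

lemma cutValue_le {C : Set Ω0} {D : Set Ω1} (hC : MeasurableSet C) (hD : MeasurableSet D)
    (h : ∀ z ∈ A, z.1 ∈ C ∨ z.2 ∈ D) : cutValue a b A ≤ a C + b D :=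
  iInf_le_of_le C (iInf_le_of_le D (iInf_le _ ⟨hC, hD, h⟩))

lemma exists_cut_lt {c : ℝ≥0∞} (h : cutValue a b A < c) :
    ∃ C D, MeasurableSet C ∧ MeasurableSet D ∧ (∀ z ∈ A, z.1 ∈ C ∨ z.2 ∈ D) ∧ a C + b D < c := by
  simp only [cutValue, iInf_lt_iff] at h
  obtain ⟨C, D, ⟨hC, hD, hz⟩, h⟩ := h
  exact ⟨C, D, hC, hD, hz, h⟩

lemma cutValue_ne_top [IsFiniteMeasure a] : cutValue a b A ≠ ∞ := by
  refine ne_top_of_le_ne_top (measure_ne_top a Set.univ)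
    ((cutValue_le .univ .empty fun z _ => Or.inl trivial).trans ?_)
  simp

lemma cutValue_mono : Monotone (cutValue a b) := by
  intro A A' h
  refine le_iInf₂ fun C D => le_iInf fun hCD => cutValue_le hCD.1 hCD.2.1 fun z hz => ?_
  exact hCD.2.2 z (h hz)

/-- Uncrossing a cut of `A` with a cut of a larger relation. -/
lemma cutValue_add_le_of_subset {A' : Set (Ω0 × Ω1)} (hAA' : A ⊆ A') {C C' : Set Ω0}
    {D D' : Set Ω1} (hC : MeasurableSet C) (hD : MeasurableSet D)
    (hC' : MeasurableSet C') (hD' : MeasurableSet D')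
    (h : ∀ z ∈ A, z.1 ∈ C ∨ z.2 ∈ D) (h' : ∀ z ∈ A', z.1 ∈ C' ∨ z.2 ∈ D') :
    cutValue a b A + (a (C ∩ C') + b (D ∪ D')) ≤ (a C + b D) + (a C' + b D') := by
  have h1 : cutValue a b A ≤ a (C ∪ C') + b (D ∩ D') := by
    refine cutValue_le (hC.union hC') (hD.inter hD') fun z hz => ?_
    have := h z hz
    have := h' z (hAA' hz)
    simp only [Set.mem_union, Set.mem_inter_iff]
    tauto
  calc _ ≤ (a (C ∪ C') + b (D ∩ D')) + (a (C ∩ C') + b (D ∪ D')) := by gcongr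
    _ = (a (C ∪ C') + a (C ∩ C')) + (b (D ∪ D') + b (D ∩ D')) := by ring
    _ = (a C + a C') + (b D + b D') := by
      rw [measure_union_add_inter _ hC', measure_union_add_inter _ hD']
    _ = _ := by ring

lemma cutValue_iUnion_le [IsFiniteMeasure a] (A : ℕ → Set (Ω0 × Ω1)) (hA : Monotone A) :
    cutValue a b (⋃ n, A n) ≤ ⨆ n, cutValue a b (A n) := by
  refine ENNReal.le_of_forall_pos_le_add fun ε hε _ => ?_
  obtain ⟨δ, hδ, hδε⟩ := ENNReal.exists_pos_sum_of_countable' (ENNReal.coe_pos.2 hε).ne' ℕ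
  have hex := fun n => exists_cut_lt (ENNReal.lt_add_right (cutValue_ne_top (a := a) (b := b)
    (A := A n)) (hδ n).ne')
  choose C D hC hD hCD hlt using hex
  let P : ℕ → ℕ → Set Ω0 := fun n l => {x | ∀ k ≤ l, x ∈ C (n + k)}
  let Q : ℕ → ℕ → Set Ω1 := fun n l => {y | ∃ k ≤ l, y ∈ D (n + k)}
  have hP : ∀ n l, P n (l + 1) = C n ∩ P (n + 1) l := by
    intro n l
    ext x
    simp only [P, Set.mem_ofPred_eq, Set.mem_inter_iff]
    constructor
    · intro h
      exact ⟨h 0 (by omega), fun k hk => by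
        have := h (k + 1) (by omega)
        rwa [← add_assoc, add_right_comm] at this⟩
    · rintro ⟨h0, h⟩ (_ | k) hk
      · exact h0
      · rw [← add_assoc, add_right_comm]; exact h k (by omega)
  have hQ : ∀ n l, Q n (l + 1) = D n ∪ Q (n + 1) l := by
    intro n l
    ext x
    simp only [Q, Set.mem_ofPred_eq, Set.mem_union]
    constructor
    · rintro ⟨_ | k, hk, h⟩
      · exact Or.inl h
      · exact Or.inr ⟨k, by omega, by rwa [← add_assoc, add_right_comm] at h⟩
    · rintro (h | ⟨k, hk, h⟩)
      · exact ⟨0, by omega, h⟩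
      · exact ⟨k + 1, by omega, by rwa [← add_assoc, add_right_comm]⟩
  have hPm : ∀ n l, MeasurableSet (P n l) := fun n l => by
    have : P n l = ⋂ k, ⋂ (_ : k ≤ l), C (n + k) := by ext; simp [P]
    rw [this]
    exact .iInter fun k => .iInter fun _ => hC _
  have hQm : ∀ n l, MeasurableSet (Q n l) := fun n l => by
    have : Q n l = ⋃ k, ⋃ (_ : k ≤ l), D (n + k) := by ext; simp [Q]
    rw [this]
    exact .iUnion fun k => .iUnion fun _ => hD _
  have hPQ : ∀ n l, ∀ z ∈ A n, z.1 ∈ P n l ∨ z.2 ∈ Q n l := by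
    intro n l z hz
    by_contra! hcon
    simp only [P, Q, Set.mem_ofPred_eq, not_exists, not_and, not_forall] at hcon
    obtain ⟨⟨k, hk, hx⟩, hy⟩ := hcon
    exact (hCD (n + k) z (hA (Nat.le_add_right n k) hz)).elim hx (hy k hk)
  have hcost : ∀ l n, a (P n l) + b (Q n l) ≤
      cutValue a b (A (n + l)) + ∑ k ∈ Finset.range (l + 1), δ (n + k) := by
    intro l
    induction l with
    | zero => intro n; simpa [P, Q] using (hlt n).le
    | succ l ih =>
      intro n
      have hun := cutValue_add_le_of_subset (a := a) (b := b) (hA (Nat.le_succ n)) (hC n) (hD n)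
        (hPm (n + 1) l) (hQm (n + 1) l) (hCD n) (hPQ (n + 1) l)
      rw [← hP, ← hQ] at hun
      refine (ENNReal.add_le_add_iff_left (cutValue_ne_top (a := a) (b := b) (A := A n))).1
        (hun.trans ((add_le_add (hlt n).le (ih (n + 1))).trans_eq ?_))
      rw [Finset.sum_range_succ' _ (l + 1)]
      simp only [add_zero, add_right_comm n 1, add_assoc]
      simp only [← add_assoc]
      ring
  have hbound : ∀ n l, a {x | ∀ k, x ∈ C (n + k)} + b (Q n l) ≤
      (⨆ n, cutValue a b (A n)) + ε := by
    intro n l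
    have hsub : {x | ∀ k, x ∈ C (n + k)} ⊆ P n l := fun x hx k _ => hx k
    refine (add_le_add (measure_mono hsub) le_rfl).trans
      ((hcost l n).trans (add_le_add (le_iSup (fun n => cutValue a b (A n)) _) ?_))
    refine le_trans ?_ hδε.le
    refine (ENNReal.sum_le_tsum _).trans ?_
    exact ENNReal.tsum_comp_le_tsum_of_injective (add_right_injective n) δ
  let D' : Set Ω1 := ⋂ n, ⋃ k, D (n + k)
  have hD' : MeasurableSet D' := .iInter fun n => .iUnion fun k => hD _
  have hbound' : ∀ n, a {x | ∀ k, x ∈ C (n + k)} + b D' ≤ (⨆ n, cutValue a b (A n)) + ε := by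
    intro n
    have h1 : D' ⊆ ⋃ l, Q n l := by
      intro y hy
      obtain ⟨k, hk⟩ := Set.mem_iUnion.1 (Set.mem_iInter.1 hy n)
      exact Set.mem_iUnion.2 ⟨k, k, le_rfl, hk⟩
    have h2 : Monotone (Q n) := fun l l' hl y ⟨k, hk, h⟩ => ⟨k, hk.trans hl, h⟩
    refine (add_le_add le_rfl (measure_mono h1)).trans ?_
    rw [h2.measure_iUnion, ENNReal.add_iSup]
    exact iSup_le (hbound n)
  have hCm : ∀ n, MeasurableSet {x | ∀ k, x ∈ C (n + k)} := fun n => by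
    have : {x | ∀ k, x ∈ C (n + k)} = ⋂ k, C (n + k) := by ext; simp
    rw [this]
    exact .iInter fun k => hC _
  have hCmono : Monotone fun n => {x | ∀ k, x ∈ C (n + k)} := by
    intro n n' hn x hx k
    obtain ⟨j, rfl⟩ := Nat.exists_eq_add_of_le hn
    rw [add_assoc]; exact hx _
  refine (cutValue_le (.iUnion hCm) hD' ?_).trans ?_
  · intro z hz
    obtain ⟨n, hn⟩ := Set.mem_iUnion.1 hz
    by_contra! hcon
    obtain ⟨hx, hy⟩ := hcon
    refine hy (Set.mem_iInter.2 fun j => ?_)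
    have : z.1 ∉ {x | ∀ k, x ∈ C (n + j + k)} := fun h => hx (Set.mem_iUnion.2 ⟨n + j, h⟩)
    simp only [Set.mem_ofPred_eq, not_forall] at this
    obtain ⟨k, hk⟩ := this
    refine Set.mem_iUnion.2 ⟨n + k, ?_⟩
    have := (hCD (n + j + k) z (hA (by omega) hn)).resolve_left hk
    rwa [show j + (n + k) = n + j + k by ring]
  · rw [hCmono.measure_iUnion, ENNReal.iSup_add]
    exact iSup_le hbound'

lemma exists_isOpen_cutValue_lt {Ω0 Ω1 : Type*} [TopologicalSpace Ω0] [MeasurableSpace Ω0]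
    [TopologicalSpace Ω1] [MeasurableSpace Ω1] [OpensMeasurableSpace Ω0] [OpensMeasurableSpace Ω1]
    {a : Measure Ω0} {b : Measure Ω1} [a.OuterRegular] [b.OuterRegular] {A : Set (Ω0 × Ω1)}
    {c : ℝ≥0∞} (h : cutValue a b A < c) : ∃ U, IsOpen U ∧ A ⊆ U ∧ cutValue a b U < c := by
  obtain ⟨C, D, hC, hD, hCD, hlt⟩ := exists_cut_lt h
  obtain ⟨r, s, hr, hs, hrs⟩ : ∃ r s, a C < r ∧ b D < s ∧ r + s ≤ c := by
    have hne : a C + b D ≠ ∞ := hlt.ne_top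
    have ha : a C ≠ ∞ := fun h => hne (by simp [h])
    have hb : b D ≠ ∞ := fun h => hne (by simp [h])
    have hpos : (c - (a C + b D)) / 2 ≠ 0 := by
      simpa [tsub_eq_zero_iff_le] using hlt
    refine ⟨_, _, ENNReal.lt_add_right ha hpos, ENNReal.lt_add_right hb hpos, ?_⟩
    rw [add_add_add_comm, ENNReal.add_halves, add_tsub_cancel_of_le hlt.le]
  obtain ⟨U, hCU, hU, hUr⟩ := C.exists_isOpen_lt_of_lt r hr
  obtain ⟨V, hDV, hV, hVs⟩ := D.exists_isOpen_lt_of_lt s hs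
  refine ⟨Prod.fst ⁻¹' U ∪ Prod.snd ⁻¹' V, (hU.preimage continuous_fst).union
    (hV.preimage continuous_snd), fun z hz => (hCD z hz).imp (@hCU _) (@hDV _), ?_⟩
  exact (cutValue_le hU.measurableSet hV.measurableSet fun z hz => hz).trans_lt
    ((ENNReal.add_lt_add hUr hVs).trans_le hrs)

end cutValue

lemma setLIntegral_meas_le_le_lintegral {Ω : Type*} [MeasurableSpace Ω] (μ : Measure Ω)
    {f : Ω → ℝ≥0} (hf : Measurable f) :
    ∫⁻ t in Set.Ioo (0 : ℝ) 1, μ {x | t ≤ f x} ≤ ∫⁻ x, f x ∂μ := by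
  have := lintegral_eq_lintegral_meas_le μ (f := fun x => (f x : ℝ))
    (.of_forall fun x => NNReal.coe_nonneg _) hf.coe_nnreal_real.aemeasurable
  simp only [ENNReal.ofReal_coe_nnreal] at this
  rw [this]
  exact lintegral_mono_set Set.Ioo_subset_Ioi_self

lemma setLIntegral_meas_one_sub_le_le_lintegral {Ω : Type*} [MeasurableSpace Ω] (μ : Measure Ω)
    {f : Ω → ℝ≥0} (hf : Measurable f) :
    ∫⁻ t in Set.Ioo (0 : ℝ) 1, μ {x | 1 - t ≤ f x} ≤ ∫⁻ x, f x ∂μ := by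
  refine le_trans (le_of_eq ?_) (setLIntegral_meas_le_le_lintegral μ hf)
  rw [← (Measure.measurePreserving_sub_left volume (1 : ℝ)).setLIntegral_comp_preimage_emb
    (MeasurableEquiv.subLeft (1 : ℝ)).measurableEmbedding (fun t => μ {x | t ≤ f x})]
  congr 2
  ext t
  simp only [Set.mem_Ioo, Set.mem_preimage]
  constructor <;> rintro ⟨_, _⟩ <;> constructor <;> linarith

lemma cutValue_le_lintegral {Ω0 Ω1 : Type*} [MeasurableSpace Ω0] [MeasurableSpace Ω1]
    {a : Measure Ω0} {b : Measure Ω1} {A : Set (Ω0 × Ω1)} {f : Ω0 → ℝ≥0} {g : Ω1 → ℝ≥0}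
    (hf : Measurable f) (hg : Measurable g) (h : ∀ z ∈ A, 1 ≤ f z.1 + g z.2) :
    cutValue a b A ≤ ∫⁻ x, f x ∂a + ∫⁻ y, g y ∂b := by
  have hanti : Antitone fun t : ℝ => a {x | t ≤ f x} := fun s t hst =>
    measure_mono fun x hx => hst.trans hx
  calc cutValue a b A = ∫⁻ t in Set.Ioo (0 : ℝ) 1, cutValue a b A := by simp
    _ ≤ ∫⁻ t in Set.Ioo (0 : ℝ) 1, (a {x | t ≤ f x} + b {y | 1 - t ≤ g y}) := by
      refine lintegral_mono fun t => cutValue_le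
        (measurableSet_le measurable_const hf.coe_nnreal_real)
        (measurableSet_le measurable_const hg.coe_nnreal_real) fun z hz => ?_
      have h1 : (1 : ℝ) ≤ f z.1 + g z.2 := by exact_mod_cast h z hz
      by_contra! hcon
      simp only [Set.mem_ofPred_eq, not_le] at hcon
      linarith
    _ = (∫⁻ t in Set.Ioo (0 : ℝ) 1, a {x | t ≤ f x}) +
        ∫⁻ t in Set.Ioo (0 : ℝ) 1, b {y | 1 - t ≤ g y} := lintegral_add_left hanti.measurable _
    _ ≤ _ := add_le_add (setLIntegral_meas_le_le_lintegral a hf)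
        (setLIntegral_meas_one_sub_le_le_lintegral b hg)

open scoped BoundedContinuousFunction CompactlySupported Topology

lemma MeasureTheory.Measure.le_of_forall_integral_le {Ω : Type*} [TopologicalSpace Ω]
    [TopologicalSpace.PseudoMetrizableSpace Ω] [MeasurableSpace Ω] [BorelSpace Ω] {μ ν : Measure Ω}
    [IsFiniteMeasure μ] [IsFiniteMeasure ν]
    (h : ∀ f : Ω →ᵇ ℝ≥0, ∫ x, (f x : ℝ) ∂μ ≤ ∫ x, (f x : ℝ) ∂ν) : μ ≤ ν := by
  have hl : ∀ f : Ω →ᵇ ℝ≥0, ∫⁻ x, f x ∂μ ≤ ∫⁻ x, f x ∂ν := by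
    intro f
    rw [← ENNReal.toReal_le_toReal (f.lintegral_lt_top_of_nnreal μ).ne
      (f.lintegral_lt_top_of_nnreal ν).ne]
    simpa only [BoundedContinuousFunction.toReal_lintegral_coe_eq_integral] using h f
  have hcl : ∀ F : Set Ω, IsClosed F → μ F ≤ ν F := fun F hF =>
    le_of_tendsto_of_tendsto' (HasOuterApproxClosed.tendsto_lintegral_apprSeq hF μ)
      (HasOuterApproxClosed.tendsto_lintegral_apprSeq hF ν) fun n => hl _
  let := TopologicalSpace.pseudoMetrizableSpacePseudoMetric Ω
  refine Measure.le_iff.2 fun s hs => ?_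
  rw [hs.measure_eq_iSup_isClosed_of_ne_top (measure_ne_top μ s)]
  exact iSup₂_le fun F hF => iSup_le fun hFc => (hcl F hFc).trans (measure_mono hF)

section Duality

variable {X Ω0 Ω1 : Type*} [TopologicalSpace Ω0] [MeasurableSpace Ω0]
  [TopologicalSpace Ω1] [MeasurableSpace Ω1]

/-- The costs of the continuous separable majorants of `h`. -/
def majorantCosts (u : X → Ω0) (v : X → Ω1) (a : Measure Ω0) (b : Measure Ω1) (h : X → ℝ) :
    Set ℝ :=
  {r | ∃ (f : Ω0 →ᵇ ℝ≥0) (g : Ω1 →ᵇ ℝ≥0), (∀ x, h x ≤ f (u x) + g (v x)) ∧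
    r = ∫ x, (f x : ℝ) ∂a + ∫ y, (g y : ℝ) ∂b}

variable {u : X → Ω0} {v : X → Ω1} {a : Measure Ω0} {b : Measure Ω1}

lemma nonneg_of_mem_majorantCosts {h : X → ℝ} {r : ℝ} (hr : r ∈ majorantCosts u v a b h) :
    0 ≤ r := by
  obtain ⟨f, g, -, rfl⟩ := hr
  positivity

lemma bddBelow_majorantCosts (h : X → ℝ) : BddBelow (majorantCosts u v a b h) :=
  ⟨0, fun _ hr => nonneg_of_mem_majorantCosts hr⟩

lemma smul_mem_majorantCosts {h : X → ℝ} {r : ℝ} (hr : r ∈ majorantCosts u v a b h) (c : ℝ≥0) :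
    c * r ∈ majorantCosts u v a b (fun x => c * h x) := by
  obtain ⟨f, g, hfg, rfl⟩ := hr
  refine ⟨c • f, c • g, fun x => ?_, ?_⟩
  · simpa [mul_add] using mul_le_mul_of_nonneg_left (hfg x) c.coe_nonneg
  · simp [integral_const_mul, mul_add]

lemma add_mem_majorantCosts [OpensMeasurableSpace Ω0] [OpensMeasurableSpace Ω1]
    [IsFiniteMeasure a] [IsFiniteMeasure b] {h h' : X → ℝ} {r r' : ℝ}
    (hr : r ∈ majorantCosts u v a b h) (hr' : r' ∈ majorantCosts u v a b h') :
    r + r' ∈ majorantCosts u v a b (fun x => h x + h' x) := by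
  obtain ⟨f, g, hfg, rfl⟩ := hr
  obtain ⟨f', g', hfg', rfl⟩ := hr'
  refine ⟨f + f', g + g', fun x => ?_, ?_⟩
  · have h1 := hfg x
    have h2 := hfg' x
    simp only [BoundedContinuousFunction.coe_add, Pi.add_apply, NNReal.coe_add]
    linarith
  · simp only [BoundedContinuousFunction.coe_add, Pi.add_apply, NNReal.coe_add]
    have h1 : ∫ x, ((f x : ℝ) + f' x) ∂a = ∫ x, (f x : ℝ) ∂a + ∫ x, (f' x : ℝ) ∂a :=
      integral_add (f.integrable_of_nnreal a) (f'.integrable_of_nnreal a)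
    have h2 : ∫ y, ((g y : ℝ) + g' y) ∂b = ∫ y, (g y : ℝ) ∂b + ∫ y, (g' y : ℝ) ∂b :=
      integral_add (g.integrable_of_nnreal b) (g'.integrable_of_nnreal b)
    rw [h1, h2]
    ring

variable [TopologicalSpace X]

lemma majorantCosts_nonempty [CompactSpace X] {h : X → ℝ} (hh : Continuous h) :
    (majorantCosts u v a b h).Nonempty := by
  obtain ⟨M, hM⟩ := isCompact_univ.exists_bound_of_continuousOn hh.continuousOn
  refine ⟨_, BoundedContinuousFunction.const _ M.toNNReal, 0, fun x => ?_, rfl⟩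
  have := (le_abs_self _).trans (hM x trivial)
  simpa using Or.inl this

/-- Kantorovich-type duality on a compact space: a lower bound for the costs of the separable
majorants of `1` is attained by the mass of a measure with dominated marginals. -/
lemma exists_measure_map_le_of_majorantCosts [CompactSpace X] [T2Space X] [MeasurableSpace X]
    [BorelSpace X] [Nonempty X] [TopologicalSpace.PseudoMetrizableSpace Ω0]
    [TopologicalSpace.PseudoMetrizableSpace Ω1] [BorelSpace Ω0] [BorelSpace Ω1]
    [IsFiniteMeasure a] [IsFiniteMeasure b] (hu : Continuous u) (hv : Continuous v) {c : ℝ}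
    (hc0 : 0 ≤ c) (hc : ∀ r ∈ majorantCosts u v a b 1, c ≤ r) :
    ∃ μ : Measure X, IsFiniteMeasure μ ∧ μ.map u ≤ a ∧ μ.map v ≤ b ∧ c ≤ μ.real Set.univ := by
  let N : C_c(X, ℝ) → ℝ := fun h => sInf (majorantCosts u v a b h)
  have hN_le : ∀ (h : C_c(X, ℝ)) (r : ℝ), r ∈ majorantCosts u v a b h → N h ≤ r := fun h r hr =>
    csInf_le (bddBelow_majorantCosts _) hr
  have hle_N : ∀ (h : C_c(X, ℝ)) (r : ℝ), (∀ s ∈ majorantCosts u v a b h, r ≤ s) → r ≤ N h :=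
    fun h r hr => le_csInf (majorantCosts_nonempty h.continuous) hr
  have hN_nonneg : ∀ h, 0 ≤ N h := fun h => hle_N h 0 fun s hs => nonneg_of_mem_majorantCosts hs
  have hsmul_le : ∀ t : ℝ, 0 < t → ∀ h, N (t • h) ≤ t * N h := by
    intro t ht h
    rw [← div_le_iff₀' ht]
    refine hle_N h _ fun s hs => ?_
    rw [div_le_iff₀' ht]
    exact hN_le (t • h) _ (smul_mem_majorantCosts hs ⟨t, ht.le⟩)
  have hsmul : ∀ t : ℝ, 0 < t → ∀ h, N (t • h) = t * N h := by
    intro t ht h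
    refine le_antisymm (hsmul_le t ht h) ?_
    have := hsmul_le t⁻¹ (inv_pos.2 ht) (t • h)
    rwa [inv_smul_smul₀ ht.ne', ← div_eq_inv_mul, le_div_iff₀' ht] at this
  have hadd : ∀ h h', N (h + h') ≤ N h + N h' := by
    intro h h'
    rw [← sub_le_iff_le_add]
    refine hle_N h _ fun s hs => ?_
    rw [sub_le_comm]
    refine hle_N h' _ fun s' hs' => ?_
    rw [sub_le_iff_le_add']
    exact hN_le (h + h') _ (add_mem_majorantCosts hs hs')
  let e : C_c(X, ℝ) := CompactlySupportedContinuousMap.continuousMapEquiv (1 : C(X, ℝ))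
  have he : ∀ x, e x = 1 := fun x => rfl
  have he0 : e ≠ 0 := by
    intro h
    obtain ⟨x⟩ := ‹Nonempty X›
    have := he x
    rw [h] at this
    simp at this
  have hNe : c ≤ N e := hle_N e c hc
  obtain ⟨ℓ, hℓe, hℓN⟩ := exists_extension_of_le_sublinear
    (LinearPMap.mkSpanSingleton (K := ℝ) (σ := RingHom.id ℝ) e c he0) N hsmul hadd (by
      rintro ⟨x, hx⟩
      obtain ⟨t, rfl⟩ := Submodule.mem_span_singleton.1 hx
      rw [LinearPMap.mkSpanSingleton'_apply]
      simp only [RingHom.id_apply, smul_eq_mul]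
      rcases lt_or_ge 0 t with ht | ht
      · rw [hsmul t ht]
        gcongr
      · exact (mul_nonpos_of_nonpos_of_nonneg ht hc0).trans (hN_nonneg _))
  have hℓ1 : ℓ e = c := (hℓe ⟨e, Submodule.mem_span_singleton_self e⟩).trans
    (LinearPMap.mkSpanSingleton'_apply_self _ _ _ _)
  have hpos : ∀ h, 0 ≤ h → 0 ≤ ℓ h := by
    intro h hh
    have h1 : N (-h) ≤ 0 := hN_le (-h) 0 ⟨0, 0, fun x => by simpa using hh x, by simp⟩
    have h2 := (hℓN (-h)).trans h1
    rw [map_neg] at h2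
    linarith
  let Λ : C_c(X, ℝ) →ₚ[ℝ] ℝ := PositiveLinearMap.mk₀ ℓ hpos
  let μ := RealRMK.rieszMeasure Λ
  have hμ : ∀ h : C_c(X, ℝ), ∫ x, h x ∂μ = ℓ h := fun h => RealRMK.integral_rieszMeasure Λ h
  have hfin : IsFiniteMeasure μ := inferInstance
  refine ⟨μ, hfin, Measure.le_of_forall_integral_le fun f => ?_,
    Measure.le_of_forall_integral_le fun g => ?_, ?_⟩
  · rw [integral_map hu.aemeasurable (by fun_prop)]
    let h : C_c(X, ℝ) := CompactlySupportedContinuousMap.continuousMapEquiv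
      ⟨fun x => (f (u x) : ℝ), by fun_prop⟩
    exact (hμ h).trans_le ((hℓN h).trans (hN_le h _ ⟨f, 0, fun x => by simp [h], by simp⟩))
  · rw [integral_map hv.aemeasurable (by fun_prop)]
    let h : C_c(X, ℝ) := CompactlySupportedContinuousMap.continuousMapEquiv
      ⟨fun x => (g (v x) : ℝ), by fun_prop⟩
    exact (hμ h).trans_le ((hℓN h).trans (hN_le h _ ⟨0, g, fun x => by simp [h], by simp⟩))
  · have := hμ e
    rw [hℓ1] at this
    simp only [he, integral_const, smul_eq_mul, mul_one] at this
    exact this.ge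

end Duality

/-- On a compact relation, the minimal cut value is attained by a flow. -/
lemma IsCompact.exists_flow_cutValue_le {Ω0 Ω1 : Type*}
    [TopologicalSpace Ω0] [PolishSpace Ω0] [MeasurableSpace Ω0] [BorelSpace Ω0]
    [TopologicalSpace Ω1] [PolishSpace Ω1] [MeasurableSpace Ω1] [BorelSpace Ω1]
    {K : Set (Ω0 × Ω1)} (hK : IsCompact K)
    (a : Measure Ω0) (b : Measure Ω1) [IsFiniteMeasure a] [IsFiniteMeasure b] :
    ∃ σ : Measure (Ω0 × Ω1), σ Kᶜ = 0 ∧ σ.map Prod.fst ≤ a ∧ σ.map Prod.snd ≤ b ∧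
      cutValue a b K ≤ σ Set.univ := by
  rcases K.eq_empty_or_nonempty with rfl | hne
  · refine ⟨0, by simp, by simp [Measure.zero_le], by simp [Measure.zero_le], ?_⟩
    simpa using cutValue_le (a := a) (b := b) (A := ∅) .empty .empty (by simp)
  have : CompactSpace K := isCompact_iff_compactSpace.1 hK
  have : Nonempty K := hne.to_subtype
  have hfst : Continuous fun z : K => z.1.1 := by fun_prop
  have hsnd : Continuous fun z : K => z.1.2 := by fun_prop
  obtain ⟨μ, hμ, ha, hb, hc⟩ := exists_measure_map_le_of_majorantCosts (a := a) (b := b) hfst hsnd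
    (c := (cutValue a b K).toReal) ENNReal.toReal_nonneg (by
      rintro _ ⟨f, g, hfg, rfl⟩
      rw [← BoundedContinuousFunction.toReal_lintegral_coe_eq_integral,
        ← BoundedContinuousFunction.toReal_lintegral_coe_eq_integral,
        ← ENNReal.toReal_add (f.lintegral_lt_top_of_nnreal a).ne
          (g.lintegral_lt_top_of_nnreal b).ne]
      refine ENNReal.toReal_mono (ENNReal.add_ne_top.2 ⟨(f.lintegral_lt_top_of_nnreal a).ne,
          (g.lintegral_lt_top_of_nnreal b).ne⟩) ?_
      refine cutValue_le_lintegral f.continuous.measurable g.continuous.measurable fun z hz => ?_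
      exact_mod_cast hfg ⟨z, hz⟩)
  refine ⟨μ.map Subtype.val, ?_, ?_, ?_, ?_⟩
  · rw [Measure.map_apply measurable_subtype_coe hK.measurableSet.compl]
    simp
  · rwa [Measure.map_map measurable_fst measurable_subtype_coe]
  · rwa [Measure.map_map measurable_snd measurable_subtype_coe]
  · rw [Measure.map_apply measurable_subtype_coe .univ, Set.preimage_univ]
    exact (ENNReal.toReal_le_toReal cutValue_ne_top (MeasureTheory.measure_ne_top μ _)).1 hc

theorem measurable_maxflow_mincut_bipartite
    {Ω0 Ω1 : Type}
    [TopologicalSpace Ω0] [PolishSpace Ω0] [MeasurableSpace Ω0] [BorelSpace Ω0]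
    [TopologicalSpace Ω1] [PolishSpace Ω1] [MeasurableSpace Ω1] [BorelSpace Ω1]
    (E : Set (Ω0 × Ω1)) (hE : MeasurableSet E)
    (a : Measure Ω0) (b : Measure Ω1) [IsFiniteMeasure a] [IsFiniteMeasure b] :
    (∀ C : Set Ω0, MeasurableSet C →
        MeasureTheory.AnalyticSet {y : Ω1 | ∃ x ∈ Cᶜ, (x, y) ∈ E} ∧
        ∀ μ : Measure Ω1, IsFiniteMeasure μ →
          NullMeasurableSet {y : Ω1 | ∃ x ∈ Cᶜ, (x, y) ∈ E} μ) ∧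
      (⨆ σ ∈ {σ : Measure (Ω0 × Ω1) |
          σ Eᶜ = 0 ∧ σ.map Prod.fst ≤ a ∧ σ.map Prod.snd ≤ b}, σ Set.univ)
        = ⨅ (C : Set Ω0) (_ : MeasurableSet C),
            a C + b {y : Ω1 | ∃ x ∈ Cᶜ, (x, y) ∈ E} := by
  have hN1 : ∀ C : Set Ω0, MeasurableSet C → AnalyticSet {y : Ω1 | ∃ x ∈ Cᶜ, (x, y) ∈ E} := by
    intro C hC
    have : {y : Ω1 | ∃ x ∈ Cᶜ, (x, y) ∈ E} = Prod.snd '' (Prod.fst ⁻¹' Cᶜ ∩ E) := by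
      ext y; simp
    rw [this]
    exact ((measurable_fst hC.compl).inter hE).analyticSet.image_of_continuous continuous_snd
  refine ⟨fun C hC => ⟨hN1 C hC, fun μ _ => (hN1 C hC).nullMeasurableSet μ⟩, le_antisymm ?_ ?_⟩
  · refine iSup₂_le fun σ hσ => le_iInf₂ fun C hC => ?_
    obtain ⟨h0, ha, hb⟩ := hσ
    set M := toMeasurable b {y : Ω1 | ∃ x ∈ Cᶜ, (x, y) ∈ E}
    have hM : MeasurableSet M := measurableSet_toMeasurable _ _
    have hcov : Set.univ ⊆ Eᶜ ∪ (Prod.fst ⁻¹' C ∪ Prod.snd ⁻¹' M) := by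
      rintro ⟨x, y⟩ -
      by_cases hxy : (x, y) ∈ E
      · by_cases hx : x ∈ C
        · exact Or.inr (Or.inl hx)
        · exact Or.inr (Or.inr (subset_toMeasurable b _ ⟨x, hx, hxy⟩))
      · exact Or.inl hxy
    calc σ Set.univ ≤ σ Eᶜ + (σ (Prod.fst ⁻¹' C) + σ (Prod.snd ⁻¹' M)) :=
          (measure_mono hcov).trans ((measure_union_le _ _).trans
            (add_le_add le_rfl (measure_union_le _ _)))
      _ = σ.map Prod.fst C + σ.map Prod.snd M := by
          rw [h0, zero_add, Measure.map_apply measurable_fst hC, Measure.map_apply measurable_snd hM]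
      _ ≤ a C + b M := add_le_add (ha C) (hb M)
      _ = _ := by rw [measure_toMeasurable]
  · have hcut : ⨅ (C : Set Ω0) (_ : MeasurableSet C),
        a C + b {y : Ω1 | ∃ x ∈ Cᶜ, (x, y) ∈ E} ≤ cutValue a b E := by
      refine le_iInf₂ fun C D => le_iInf fun ⟨hC, _, hCD⟩ => iInf₂_le_of_le C hC ?_
      gcongr
      rintro y ⟨x, hx, hxy⟩
      exact (hCD _ hxy).resolve_left hx
    refine hcut.trans (le_of_forall_lt fun c hc => ?_)
    obtain ⟨c', hcc', hc'⟩ := exists_between hc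
    let := TopologicalSpace.upgradeIsCompletelyMetrizable Ω0
    let := TopologicalSpace.upgradeIsCompletelyMetrizable Ω1
    obtain ⟨K, hK, hKE, hle⟩ := hE.analyticSet.exists_isCompact_lt_of_capacity cutValue_mono
      cutValue_iUnion_le (fun K _ c h => exists_isOpen_cutValue_lt h) hc'
    obtain ⟨σ, hσK, ha, hb, hσ⟩ := hK.exists_flow_cutValue_le a b
    refine hcc'.trans_le (hle.trans (hσ.trans (le_iSup₂_of_le σ ⟨?_, ha, hb⟩ le_rfl)))
    exact measure_mono_null (Set.compl_subset_compl.2 hKE) hσK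
end
end
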